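/- arXiv:1312.7781 — 2 statements merged into one kernel-verified Lean document; each statement's English description precedes it below -/
import Mathlib

section
/- Fix n ≥ 2. Let Art(C̃_n) be the group presented by generators u₀, u₁, …, u_n with relations: u₀u₁u₀u₁ = u₁u₀u₁u₀; u_{n−1}u_nu_{n−1}u_n = u_nu_{n−1}u_nu_{n−1}; uᵢu_{i+1}uᵢ = u_{i+1}uᵢu_{i+1} for 1 ≤ i ≤ n−2; and uᵢu_j = u_juᵢ whenever |i − j| ≥ 2. Then Art(C̃_n) is torsion-free and its center is trivial. -/
/-- The standard presentation relations for the euclidean Artin group `Art(C̃_n)` on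
generators `u₀, …, u_n`:  `u₀u₁u₀u₁ = u₁u₀u₁u₀`;
`u_{n−1}u_nu_{n−1}u_n = u_nu_{n−1}u_nu_{n−1}`;
`uᵢu_{i+1}uᵢ = u_{i+1}uᵢu_{i+1}` for `1 ≤ i ≤ n − 2`; and `uᵢu_j = u_juᵢ` whenever
`|i − j| ≥ 2`. -/
def relsArtinCtilde (n : ℕ) : Set (FreeGroup (Fin (n + 1))) :=
  {x | ∃ i j : Fin (n + 1), (i : ℕ) = 0 ∧ (j : ℕ) = 1 ∧
      x = FreeGroup.of i * FreeGroup.of j * FreeGroup.of i * FreeGroup.of j *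
        (FreeGroup.of j * FreeGroup.of i * FreeGroup.of j * FreeGroup.of i)⁻¹} ∪
  {x | ∃ i j : Fin (n + 1), (i : ℕ) + 1 = n ∧ (j : ℕ) = n ∧
      x = FreeGroup.of i * FreeGroup.of j * FreeGroup.of i * FreeGroup.of j *
        (FreeGroup.of j * FreeGroup.of i * FreeGroup.of j * FreeGroup.of i)⁻¹} ∪
  {x | ∃ i j : Fin (n + 1), (i : ℕ) + 1 = (j : ℕ) ∧ 1 ≤ (i : ℕ) ∧ (i : ℕ) + 2 ≤ n ∧
      x = FreeGroup.of i * FreeGroup.of j * FreeGroup.of i *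
        (FreeGroup.of j * FreeGroup.of i * FreeGroup.of j)⁻¹} ∪
  {x | ∃ i j : Fin (n + 1), ((i : ℕ) + 2 ≤ (j : ℕ) ∨ (j : ℕ) + 2 ≤ (i : ℕ)) ∧
      x = FreeGroup.of i * FreeGroup.of j * (FreeGroup.of j * FreeGroup.of i)⁻¹}

namespace ArtinCtilde

section Filtration

variable {ι : Type*} (k : Type*) [CommRing k]

/-- The powers of the augmentation ideal of the group ring of a free group, generated as left
ideals by the products of the elements `x i - 1`. -/
noncomputable def augPow : ℕ → Submodule k (MonoidAlgebra k (FreeGroup ι))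
  | 0 => ⊤
  | m + 1 => Submodule.span k {v | ∃ u ∈ augPow m, ∃ i : ι,
      v = u * (MonoidAlgebra.of k (FreeGroup ι) (FreeGroup.of i) - 1)}

/-- The action of automorphisms of a free group on its group ring. -/
noncomputable def ringAut : MulAut (FreeGroup ι) →*
    (MonoidAlgebra k (FreeGroup ι) ≃ₐ[k] MonoidAlgebra k (FreeGroup ι)) :=
  MonoidAlgebra.domCongrAut

variable {k}

lemma of_mul_of_inv (g : FreeGroup ι) :
    MonoidAlgebra.of k (FreeGroup ι) g * MonoidAlgebra.of k _ g⁻¹ = 1 := by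
  rw [← map_mul, mul_inv_cancel, map_one]

lemma of_inv_mul_of (g : FreeGroup ι) :
    MonoidAlgebra.of k (FreeGroup ι) g⁻¹ * MonoidAlgebra.of k _ g = 1 := by
  rw [← map_mul, inv_mul_cancel, map_one]

lemma mul_of_sub_one_mem_augPow {m : ℕ} {u : MonoidAlgebra k (FreeGroup ι)}
    (hu : u ∈ augPow k m) (i : ι) :
    u * (MonoidAlgebra.of k (FreeGroup ι) (FreeGroup.of i) - 1) ∈ augPow k (m + 1) :=
  Submodule.subset_span ⟨u, hu, i, rfl⟩

lemma augPow_succ_le_comap {m m' : ℕ}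
    (f : MonoidAlgebra k (FreeGroup ι) →ₗ[k] MonoidAlgebra k (FreeGroup ι))
    (h : ∀ u ∈ augPow k m, ∀ i : ι,
      f (u * (MonoidAlgebra.of k (FreeGroup ι) (FreeGroup.of i) - 1)) ∈ augPow k m') :
    ∀ v ∈ augPow k (m + 1), f v ∈ augPow k m' := by
  intro v hv
  have : augPow k (m + 1) ≤ (augPow k m').comap f := by
    refine Submodule.span_le.2 ?_
    rintro _ ⟨u, hu, i, rfl⟩
    exact h u hu i
  exact this hv

/-- The powers of the augmentation ideal are right ideals, and multiplication by `g - 1` raises the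
exponent. -/
lemma augPow_mul_mem_and_mul_sub_one_mem (m : ℕ) :
    (∀ u ∈ augPow k m, ∀ g : FreeGroup ι, u * MonoidAlgebra.of k _ g ∈ augPow k m) ∧
    (∀ u ∈ augPow k m, ∀ g : FreeGroup ι,
      u * (MonoidAlgebra.of k _ g - 1) ∈ augPow k (m + 1)) := by
  have step : ∀ m : ℕ,
      (∀ u ∈ augPow k m, ∀ g : FreeGroup ι, u * MonoidAlgebra.of k _ g ∈ augPow k m) →
      (∀ u ∈ augPow k m, ∀ g : FreeGroup ι,
        u * (MonoidAlgebra.of k _ g - 1) ∈ augPow k (m + 1)) := by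
    intro m hP u hu g
    induction g using FreeGroup.induction_on generalizing u with
    | C1 => rw [map_one, sub_self, mul_zero]; exact zero_mem _
    | of i => exact mul_of_sub_one_mem_augPow hu i
    | inv_of i _ =>
      have h := mul_of_sub_one_mem_augPow (hP u hu (FreeGroup.of i)⁻¹) i
      have e : u * (MonoidAlgebra.of k _ (FreeGroup.of i)⁻¹ - 1) =
          -(u * MonoidAlgebra.of k _ (FreeGroup.of i)⁻¹ *
            (MonoidAlgebra.of k (FreeGroup ι) (FreeGroup.of i) - 1)) := by
        rw [mul_assoc, mul_sub (MonoidAlgebra.of k _ (FreeGroup.of i)⁻¹), of_inv_mul_of, mul_one,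
          ← mul_neg, neg_sub]
      rw [e]
      exact neg_mem h
    | mul g h ihg ihh =>
      have e : u * (MonoidAlgebra.of k _ (g * h) - 1) =
          u * MonoidAlgebra.of k _ g * (MonoidAlgebra.of k _ h - 1) +
            u * (MonoidAlgebra.of k _ g - 1) := by
        rw [map_mul]; noncomm_ring
      rw [e]
      exact add_mem (ihh _ (hP u hu g)) (ihg u hu)
  induction m with
  | zero => exact ⟨fun _ _ _ => Submodule.mem_top, step 0 fun _ _ _ => Submodule.mem_top⟩
  | succ m ih =>
    have hP : ∀ u ∈ augPow k (m + 1), ∀ g : FreeGroup ι,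
        u * MonoidAlgebra.of k _ g ∈ augPow k (m + 1) := by
      intro u hu g
      refine augPow_succ_le_comap (LinearMap.mulRight k (MonoidAlgebra.of k _ g)) ?_ u hu
      intro u hu i
      have e : u * (MonoidAlgebra.of k _ (FreeGroup.of i) - 1) * MonoidAlgebra.of k _ g =
          u * (MonoidAlgebra.of k _ (FreeGroup.of i * g) - 1) -
            u * (MonoidAlgebra.of k _ g - 1) := by
        rw [map_mul]; noncomm_ring
      rw [LinearMap.mulRight_apply, e]
      exact sub_mem (ih.2 u hu _) (ih.2 u hu _)
    exact ⟨hP, step _ hP⟩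

lemma augPow_mul_of {m : ℕ} {u : MonoidAlgebra k (FreeGroup ι)} (hu : u ∈ augPow k m)
    (g : FreeGroup ι) : u * MonoidAlgebra.of k _ g ∈ augPow k m :=
  (augPow_mul_mem_and_mul_sub_one_mem m).1 u hu g

lemma augPow_mul_sub_one {m : ℕ} {u : MonoidAlgebra k (FreeGroup ι)} (hu : u ∈ augPow k m)
    (g : FreeGroup ι) : u * (MonoidAlgebra.of k _ g - 1) ∈ augPow k (m + 1) :=
  (augPow_mul_mem_and_mul_sub_one_mem m).2 u hu g

lemma augPow_mul_conj_sub {m : ℕ} {u : MonoidAlgebra k (FreeGroup ι)} (hu : u ∈ augPow k m)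
    (g x : FreeGroup ι) :
    u * (MonoidAlgebra.of k _ (g * x * g⁻¹) - MonoidAlgebra.of k _ x) ∈ augPow k (m + 2) := by
  have e : u * (MonoidAlgebra.of k _ (g * x * g⁻¹) - MonoidAlgebra.of k _ x) =
      (u * (MonoidAlgebra.of k _ g - 1) * (MonoidAlgebra.of k _ x - 1) -
        u * (MonoidAlgebra.of k _ x - 1) * (MonoidAlgebra.of k _ g - 1)) *
          MonoidAlgebra.of k _ g⁻¹ := by
    have : u * (MonoidAlgebra.of k _ g - 1) * (MonoidAlgebra.of k _ x - 1) -
        u * (MonoidAlgebra.of k _ x - 1) * (MonoidAlgebra.of k _ g - 1) =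
        u * (MonoidAlgebra.of k _ g * MonoidAlgebra.of k _ x -
          MonoidAlgebra.of k _ x * MonoidAlgebra.of k _ g) := by noncomm_ring
    rw [this, mul_assoc u, sub_mul, mul_assoc (MonoidAlgebra.of k _ x), of_mul_of_inv, mul_one,
      map_mul, map_mul]
  rw [e]
  exact augPow_mul_of (sub_mem (augPow_mul_sub_one (augPow_mul_sub_one hu g) x)
    (augPow_mul_sub_one (augPow_mul_sub_one hu x) g)) _

lemma ringAut_of (φ : MulAut (FreeGroup ι)) (g : FreeGroup ι) :
    ringAut k φ (MonoidAlgebra.of k _ g) = MonoidAlgebra.of k _ (φ g) := by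
  simp [ringAut]

lemma augPow_ringAut (φ : MulAut (FreeGroup ι)) (m : ℕ) :
    ∀ v ∈ augPow k m, ringAut k φ v ∈ augPow k m := by
  induction m with
  | zero => exact fun _ _ => Submodule.mem_top
  | succ m ih =>
    refine augPow_succ_le_comap (ringAut k φ).toLinearMap fun u hu i => ?_
    rw [AlgEquiv.toLinearMap_apply, map_mul, map_sub, map_one, ringAut_of]
    exact augPow_mul_sub_one (ih u hu) _

lemma exists_weighted_augmentation (s : ι → k) :
    ∃ θ : MonoidAlgebra k (FreeGroup ι) →ₗ[k] MonoidAlgebra k (FreeGroup ι), ∀ u i,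
      θ (u * (MonoidAlgebra.of k _ (FreeGroup.of i) - 1)) =
        s i • (u * (MonoidAlgebra.of k _ (FreeGroup.of i) - 1)) := by
  let A := MonoidAlgebra k (FreeGroup ι)
  let o : FreeGroup ι → A := MonoidAlgebra.of k _
  have ho : ∀ g h, o (g * h) = o g * o h := fun g h => map_mul _ g h
  have hi : ∀ g, o g * o g⁻¹ = 1 := of_mul_of_inv
  have hi' : ∀ g, o g⁻¹ * o g = 1 := of_inv_mul_of
  let aff (i : ι) : Equiv.Perm A :=
    { toFun := fun a => o (.of i) * a + s i • (o (.of i) - 1)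
      invFun := fun a => o (.of i)⁻¹ * (a - s i • (o (.of i) - 1))
      left_inv := fun a => by simp [← mul_assoc, hi']
      right_inv := fun a => by simp [← mul_assoc, hi] }
  let ρ : FreeGroup ι →* Equiv.Perm A := FreeGroup.lift aff
  have hρ : ∀ g a, ρ g a = o g * a + ρ g 0 := by
    intro g
    induction g using FreeGroup.induction_on with
    | C1 => intro a; rw [show o 1 = 1 from map_one _]; simp
    | of i => intro a; simp [ρ, aff]
    | inv_of i _ =>
      intro a
      simp only [ρ, map_inv, FreeGroup.lift_apply_of]
      change o (.of i)⁻¹ * _ = _ + o (.of i)⁻¹ * _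
      noncomm_ring
    | mul g h ihg ihh =>
      intro a
      rw [map_mul, Equiv.Perm.mul_apply, Equiv.Perm.mul_apply, ihh, ihg, ihg (ρ h 0), ho]
      noncomm_ring
  refine ⟨Finsupp.linearCombination k (fun g => ρ g 0) ∘ₗ
    (MonoidAlgebra.coeffLinearEquiv k).toLinearMap, fun u i => ?_⟩
  set θ := Finsupp.linearCombination k (fun g => ρ g 0) ∘ₗ
    (MonoidAlgebra.coeffLinearEquiv k).toLinearMap with hθ
  have hθo : ∀ g, θ (o g) = ρ g 0 := by
    intro g
    simp [θ, o, MonoidAlgebra.coeffLinearEquiv]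
  induction u using MonoidAlgebra.induction_on with
  | of g =>
    change θ (o g * (o (.of i) - 1)) = s i • (o g * (o (.of i) - 1))
    rw [mul_sub, mul_one, ← ho, map_sub, hθo, hθo, map_mul, Equiv.Perm.mul_apply, hρ g, ho]
    simp [ρ, aff, mul_sub]
  | add x y hx hy => rw [add_mul, map_add, hx, hy, smul_add]
  | smul r x hx => rw [smul_mul_assoc, map_smul, hx, smul_comm]

end Filtration

section FixedPointFree

variable {ι : Type*} {p : ℕ} [Fact p.Prime]

lemma exists_orbit_weight {π : Equiv.Perm ι} (hp : π ^ p = 1) (hfix : ∀ i, π i ≠ i) :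
    ∃ s : ι → ZMod p, ∀ i, ∑ j ∈ Finset.range p, s ((π ^ j)⁻¹ i) = 1 := by
  classical
  let rep : ι → ι := fun i => (Quotient.mk (Equiv.Perm.SameCycle.setoid π) i).out
  have hrep : ∀ i, π.SameCycle (rep i) i := fun i =>
    Quotient.mk_out (s := Equiv.Perm.SameCycle.setoid π) i
  have hcongr : ∀ i (j : ℕ), rep ((π ^ j)⁻¹ i) = rep i := fun i j =>
    congrArg Quotient.out (Quotient.sound (s := Equiv.Perm.SameCycle.setoid π)
      (a := (π ^ j)⁻¹ i) (b := i) ⟨j, by simp⟩)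
  have hpz : (π ^ (p : ℤ)) = 1 := by rw [zpow_natCast, hp]
  have hp0 : 0 < p := (Fact.out : p.Prime).pos
  refine ⟨fun i => if i = rep i then 1 else 0, fun i => ?_⟩
  simp only [hcongr]
  obtain ⟨z, hz⟩ := hrep i
  have hzmod : π ^ z = π ^ (z % p).toNat := by
    rw [← zpow_natCast, Int.toNat_of_nonneg (Int.emod_nonneg _ (by omega))]
    conv_lhs => rw [← Int.emod_add_mul_ediv z p, zpow_add, zpow_mul, hpz, one_zpow, mul_one]
  have hlt : (z % p).toNat < p := by
    have := Int.emod_lt_of_pos z (b := p) (by omega)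
    have := Int.emod_nonneg z (b := p) (by omega)
    omega
  rw [hzmod] at hz
  rw [Finset.sum_eq_single (z % p).toNat]
  · rw [if_pos]
    rw [Equiv.Perm.inv_eq_iff_eq, hz]
  · intro j hj hne
    rw [if_neg]
    intro h
    rw [Equiv.Perm.inv_eq_iff_eq] at h
    rw [Finset.mem_range] at hj
    have hper : Function.IsPeriodicPt π p (rep i) := by
      rw [Function.IsPeriodicPt, Function.IsFixedPt, Equiv.Perm.iterate_eq_pow, hp]; rfl
    have hmin : Function.minimalPeriod π (rep i) = p := by
      rcases (Nat.dvd_prime Fact.out).1 hper.minimalPeriod_dvd with h | h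
      · exact absurd (Function.minimalPeriod_eq_one_iff_isFixedPt.1 h) (hfix _)
      · exact h
    refine hne (Function.iterate_injOn_Iio_minimalPeriod (f := π) (x := rep i) ?_ ?_ ?_)
    · rw [hmin]; exact hj
    · rw [hmin]; exact hlt
    · simp only [Equiv.Perm.iterate_eq_pow, hz, ← h]
  · intro h
    exact absurd (Finset.mem_range.2 hlt) h

/-- The exponent sum of an element of a free group. -/
def degree : FreeGroup ι →* Multiplicative ℤ := FreeGroup.lift fun _ => Multiplicative.ofAdd 1

lemma lift_const_apply_of_isConj {φ : MulAut (FreeGroup ι)} {π : Equiv.Perm ι}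
    (hconj : ∀ i, IsConj (φ (.of i)) (.of (π i))) (g : FreeGroup ι) {A : Type*} [CommGroup A]
    (a : A) :
    FreeGroup.lift (fun _ => a) (φ g) = FreeGroup.lift (fun _ => a) g := by
  have : (FreeGroup.lift fun _ => a).comp φ.toMonoidHom = FreeGroup.lift fun _ => a := by
    refine FreeGroup.ext_hom _ _ fun i => ?_
    have := (FreeGroup.lift (fun _ : ι => a)).map_isConj (hconj i)
    simpa using isConj_iff_eq.1 this
  exact DFunLike.congr_fun this g

lemma isConj_pow {φ : MulAut (FreeGroup ι)} {π : Equiv.Perm ι}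
    (hconj : ∀ i, IsConj (φ (.of i)) (.of (π i))) (j : ℕ) (i : ι) :
    IsConj ((φ ^ j) (.of i)) (.of ((π ^ j) i)) := by
  induction j generalizing i with
  | zero => exact IsConj.refl _
  | succ j ih =>
    rw [pow_succ, pow_succ, MulAut.mul_apply, Equiv.Perm.mul_apply]
    exact ((φ ^ j).toMonoidHom.map_isConj (hconj i)).trans (ih _)

lemma isConj_inv {φ : MulAut (FreeGroup ι)} {π : Equiv.Perm ι}
    (hconj : ∀ i, IsConj (φ (.of i)) (.of (π i))) (i : ι) :
    IsConj (φ⁻¹ (.of i)) (.of (π⁻¹ i)) := by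
  have h := φ⁻¹.toMonoidHom.map_isConj (hconj (π⁻¹ i))
  simpa using h.symm

theorem degree_eq_one_of_fixedPointFree {φ : MulAut (FreeGroup ι)} {π : Equiv.Perm ι}
    (hφ : φ ^ p = 1) (hπ : π ^ p = 1) (hfix : ∀ i, π i ≠ i)
    (hconj : ∀ i, IsConj (φ (.of i)) (.of (π i))) {d : FreeGroup ι} (hd : φ d = d) :
    degree d = 1 := by
  obtain ⟨s, hs⟩ := exists_orbit_weight hπ hfix
  obtain ⟨θ, hθ⟩ := exists_weighted_augmentation s
  let k := ZMod p
  let A := MonoidAlgebra k (FreeGroup ι)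
  have hθmem : ∀ m, ∀ v ∈ augPow k m, θ v ∈ augPow k m := by
    intro m
    cases m with
    | zero => exact fun _ _ => Submodule.mem_top
    | succ m =>
      refine augPow_succ_le_comap θ fun u hu i => ?_
      rw [hθ]
      exact Submodule.smul_mem _ _ (mul_of_sub_one_mem_augPow hu i)
  let T : A →ₗ[k] A := (∑ j ∈ Finset.range p,
    (ringAut k (φ ^ j)).toLinearMap ∘ₗ θ ∘ₗ (ringAut k (φ ^ j)⁻¹).toLinearMap) - LinearMap.id
  have hT : ∀ m, ∀ v ∈ augPow k (m + 1), T v ∈ augPow k (m + 2) := by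
    intro m
    refine augPow_succ_le_comap T fun u hu i => ?_
    have key : ∀ j : ℕ, ringAut k (φ ^ j) (θ (ringAut k (φ ^ j)⁻¹
        (u * (MonoidAlgebra.of k _ (.of i) - 1)))) -
        s ((π ^ j)⁻¹ i) • (u * (MonoidAlgebra.of k _ (.of i) - 1)) ∈ augPow k (m + 2) := by
      intro j
      obtain ⟨g, hg⟩ := isConj_iff.1 (isConj_inv (isConj_pow hconj j) i).symm
      set v := u * (MonoidAlgebra.of k (FreeGroup ι) (.of i) - 1) with hv
      set i' := (π ^ j)⁻¹ i with hi'
      set u' := ringAut k (φ ^ j)⁻¹ u with hu'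
      have hu'm : u' ∈ augPow k m := augPow_ringAut _ m u hu
      set e := u' * (MonoidAlgebra.of k _ (g * .of i' * g⁻¹) - MonoidAlgebra.of k _ (.of i')) with
        he
      have hem : e ∈ augPow k (m + 2) := augPow_mul_conj_sub hu'm _ _
      have h1 : ringAut k (φ ^ j)⁻¹ v = u' * (MonoidAlgebra.of k _ (.of i') - 1) + e := by
        rw [hv, map_mul, map_sub, map_one, ringAut_of, ← hg, he, ← mul_add]
        congr 1
        abel
      have h2 : ringAut k (φ ^ j) (ringAut k (φ ^ j)⁻¹ v) = v := by
        rw [← AlgEquiv.mul_apply, ← map_mul, mul_inv_cancel, map_one, AlgEquiv.one_apply]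
      have h3 : θ (ringAut k (φ ^ j)⁻¹ v) = s i' • (ringAut k (φ ^ j)⁻¹ v) + (θ e - s i' • e) := by
        rw [h1, map_add, hθ, smul_add]; abel
      rw [h3, map_add, map_smul, h2, add_sub_cancel_left]
      exact augPow_ringAut _ _ _ (sub_mem (hθmem _ _ hem) (Submodule.smul_mem _ _ hem))
    have e : T (u * (MonoidAlgebra.of k _ (.of i) - 1)) = ∑ j ∈ Finset.range p,
        (ringAut k (φ ^ j) (θ (ringAut k (φ ^ j)⁻¹ (u * (MonoidAlgebra.of k _ (.of i) - 1)))) -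
        s ((π ^ j)⁻¹ i) • (u * (MonoidAlgebra.of k _ (.of i) - 1))) := by
      rw [Finset.sum_sub_distrib, ← Finset.sum_smul, hs, one_smul]
      simp [T]
    rw [e]
    exact Submodule.sum_mem _ fun j _ => key j
  let unit : (PowerSeries k)ˣ :=
    ((PowerSeries.isUnit_iff_constantCoeff (φ := (1 + PowerSeries.X : PowerSeries k))).2
      (by simp)).unit
  let χ : FreeGroup ι →* (PowerSeries k)ˣ := FreeGroup.lift fun _ => unit
  let ε : A →ₐ[k] PowerSeries k := MonoidAlgebra.lift k (PowerSeries k) (FreeGroup ι)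
    ((Units.coeHom _).comp χ)
  have hεo : ∀ g, ε (MonoidAlgebra.of k _ g) = (χ g : PowerSeries k) := fun g =>
    MonoidAlgebra.lift_of _ _
  have hεφ : ∀ j : ℕ, ∀ a, ε (ringAut k (φ ^ j) a) = ε a := by
    intro j a
    induction a using MonoidAlgebra.induction_on with
    | of g => rw [ringAut_of, hεo, hεo, lift_const_apply_of_isConj (isConj_pow hconj j)]
    | add x y hx hy => simp only [map_add, hx, hy]
    | smul r x hx => simp only [map_smul, hx]
  have hεJ : ∀ m, ∀ v ∈ augPow k m, (PowerSeries.X : PowerSeries k) ^ m ∣ ε v := by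
    intro m
    induction m with
    | zero => intro v _; simp
    | succ m ih =>
      intro v hv
      have : augPow k (m + 1) ≤ ((Ideal.span
          {(PowerSeries.X : PowerSeries k) ^ (m + 1)}).restrictScalars k).comap ε.toLinearMap := by
        refine Submodule.span_le.2 ?_
        rintro _ ⟨u, hu, i, rfl⟩
        change ε _ ∈ Ideal.span _
        rw [Ideal.mem_span_singleton, map_mul, map_sub, map_one, hεo, pow_succ]
        refine mul_dvd_mul (ih u hu) ?_
        simp [χ, unit]
      exact Ideal.mem_span_singleton.1 (this hv)
  have hw : ∀ m, ∃ w ∈ augPow k (m + 1), ringAut k φ w = w ∧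
      ε w = ε (MonoidAlgebra.of k _ d - 1) := by
    intro m
    induction m with
    | zero =>
      refine ⟨MonoidAlgebra.of k _ d - 1, ?_, ?_, rfl⟩
      · simpa using augPow_mul_sub_one (k := k) (m := 0) (u := 1) Submodule.mem_top d
      · rw [map_sub, map_one, ringAut_of, hd]
    | succ m ih =>
      obtain ⟨w, hwm, hwf, hwe⟩ := ih
      have hinv : ∀ j : ℕ, ringAut k (φ ^ j)⁻¹ w = w := by
        intro j
        have : ringAut k (φ ^ j) w = w := by
          induction j with
          | zero => simp
          | succ j ih => rw [pow_succ, map_mul, AlgEquiv.mul_apply, hwf, ih]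
        conv_lhs => rw [← this]
        rw [← AlgEquiv.mul_apply, ← map_mul, inv_mul_cancel, map_one, AlgEquiv.one_apply]
      have hTw : T w = (∑ j ∈ Finset.range p, ringAut k (φ ^ j) (θ w)) - w := by
        simp only [T, LinearMap.sub_apply, LinearMap.sum_apply, LinearMap.comp_apply,
          AlgEquiv.toLinearMap_apply, hinv, LinearMap.id_apply]
      refine ⟨-T w, neg_mem (hT m w hwm), ?_, ?_⟩
      · rw [hTw, map_neg, map_sub, hwf, map_sum]
        congr 2
        have e : ∀ j : ℕ, ringAut k φ (ringAut k (φ ^ j) (θ w)) =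
            ringAut k (φ ^ (j + 1)) (θ w) := by
          intro j
          rw [pow_succ' φ, map_mul, AlgEquiv.mul_apply]
        simp only [e]
        have h1 := Finset.sum_range_succ (fun j => ringAut k (φ ^ j) (θ w)) p
        rw [Finset.sum_range_succ', hφ, pow_zero] at h1
        exact add_right_cancel h1
      · rw [hTw, map_neg, map_sub, map_sum, hwe]
        simp only [hεφ]
        have hp0 : ((p : ℕ) : PowerSeries k) = 0 := by
          have : (p : k) = 0 := ZMod.natCast_self p
          rw [← map_natCast (algebraMap k (PowerSeries k)), this, map_zero]
        rw [Finset.sum_const, Finset.card_range, nsmul_eq_mul, hp0]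
        simp
  have hzero : (χ d : PowerSeries k) = 1 := by
    have : ε (MonoidAlgebra.of k _ d - 1) = 0 := by
      ext m
      obtain ⟨w, hwm, -, hwe⟩ := hw m
      rw [← hwe]
      exact PowerSeries.X_pow_dvd_iff.1 (hεJ _ w hwm) m (Nat.lt_succ_self m)
    rwa [map_sub, map_one, hεo, sub_eq_zero] at this
  have hpow : ∀ m : ℕ, unit ^ m = 1 → m = 0 := by
    intro m hm
    have h1 : ((1 + Polynomial.X : Polynomial k) ^ m : Polynomial k) = 1 := by
      refine Polynomial.coe_injective k ?_
      have := congrArg (Units.val) hm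
      simpa [unit] using this
    have h2 := congrArg Polynomial.natDegree h1
    rw [add_comm, show (1 : Polynomial k) = Polynomial.C 1 from (map_one _).symm,
      Polynomial.natDegree_pow, Polynomial.natDegree_X_add_C] at h2
    simpa using h2
  have hχ : χ d = unit ^ (degree d).toAdd := by
    have : χ = (zpowersHom _ unit).comp degree := by
      refine FreeGroup.ext_hom _ _ fun i => ?_
      simp [χ, degree]
    rw [this]; rfl
  have hz : unit ^ (degree d).toAdd = 1 := by
    rw [← hχ]; exact Units.ext hzero
  have : (degree d).toAdd = 0 := by
    rcases Int.eq_nat_or_neg (degree d).toAdd with ⟨m, h | h⟩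
    · rw [h, zpow_natCast] at hz
      rw [h, hpow m hz]; rfl
    · rw [h, zpow_neg, zpow_natCast, inv_eq_one] at hz
      rw [h, hpow m hz]; rfl
  exact this

end FixedPointFree

section FreeGroup

lemma eq_of_commute_of {X : Type*} {a b : X}
    (h : Commute (FreeGroup.of a) (FreeGroup.of b)) : a = b := by
  classical
  by_contra hab
  have := h.map (FreeGroup.lift fun x => if x = a then (Equiv.swap 0 1 : Equiv.Perm (Fin 3))
    else Equiv.swap 1 2)
  simp only [FreeGroup.lift_apply_of, if_true, if_neg (Ne.symm hab)] at this
  exact absurd this.eq (by decide)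

/-- Commuting elements of a free group are powers of a common element. -/
lemma exists_zpow_zpow_of_commute {X : Type*} {f g : FreeGroup X} (h : Commute f g) :
    ∃ c : FreeGroup X, ∃ m l : ℤ, f = c ^ m ∧ g = c ^ l := by
  classical
  let C := Subgroup.closure {f, g}
  have hcomm : ∀ x y : C, x * y = y * x := by
    have := Subgroup.closure_le_centralizer_centralizer ({f, g} : Set (FreeGroup X))
    have hfg : ∀ x ∈ ({f, g} : Set (FreeGroup X)), ∀ y ∈ ({f, g} : Set (FreeGroup X)),
        x * y = y * x := by
      rintro x (rfl | rfl) y (rfl | rfl)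
      · rfl
      · exact h
      · exact h.symm
      · rfl
    have := Subgroup.isMulCommutative_closure hfg
    exact fun x y => this.is_comm.comm x y
  let e := IsFreeGroup.toFreeGroup C
  have hsub : Subsingleton (IsFreeGroup.Generators C) := by
    refine ⟨fun a b => eq_of_commute_of ?_⟩
    have := hcomm (e.symm (.of a)) (e.symm (.of b))
    rw [← map_mul, ← map_mul] at this
    exact e.symm.injective this
  obtain ⟨c, hc⟩ : ∃ c : FreeGroup (IsFreeGroup.Generators C), ∀ x, x ∈ Subgroup.zpowers c := by
    rcases isEmpty_or_nonempty (IsFreeGroup.Generators C) with hE | ⟨⟨a⟩⟩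
    · exact ⟨1, fun x => by rw [Subsingleton.elim x 1]; exact one_mem _⟩
    · refine ⟨.of a, fun x => ?_⟩
      induction x using FreeGroup.induction_on with
      | C1 => exact one_mem _
      | of b => rw [Subsingleton.elim b a]; exact Subgroup.mem_zpowers _
      | inv_of b h => exact inv_mem h
      | mul x y hx hy => exact mul_mem hx hy
  have key : ∀ x ∈ C, ∃ m : ℤ, x = ((e.symm c : C) : FreeGroup X) ^ m := by
    intro x hx
    obtain ⟨m, hm⟩ := hc (e ⟨x, hx⟩)
    refine ⟨m, ?_⟩
    have := congrArg (fun y => ((e.symm y : C) : FreeGroup X)) hm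
    simpa using this.symm
  obtain ⟨m, hm⟩ := key f (Subgroup.subset_closure (by simp))
  obtain ⟨l, hl⟩ := key g (Subgroup.subset_closure (by simp))
  exact ⟨_, m, l, hm, hl⟩

lemma exists_eq_zpow_of_commute {X : Type*} {f g : FreeGroup X} (h : Commute f g)
    {χ : FreeGroup X →* Multiplicative ℤ} (hχ : χ g = Multiplicative.ofAdd 1) :
    ∃ m : ℤ, f = g ^ m := by
  obtain ⟨c, m, l, rfl, rfl⟩ := exists_zpow_zpow_of_commute h
  have hl : l * (χ c).toAdd = 1 := by
    have := congrArg Multiplicative.toAdd hχ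
    simpa [map_zpow] using this
  have hl' : l * l = 1 := by
    rcases Int.isUnit_iff.1 (IsUnit.of_mul_eq_one _ hl) with h | h <;> rw [h] <;> rfl
  exact ⟨l * m, by rw [← zpow_mul, ← mul_assoc, hl', one_mul]⟩

/-- The exponent sum of a generator. -/
def expSum {X : Type*} [DecidableEq X] (a : X) : FreeGroup X →* Multiplicative ℤ :=
  FreeGroup.lift fun x => if x = a then Multiplicative.ofAdd 1 else 1

lemma expSum_of {X : Type*} [DecidableEq X] (a x : X) :
    expSum a (.of x) = if x = a then Multiplicative.ofAdd 1 else 1 :=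
  FreeGroup.lift_apply_of

lemma exists_eq_zpow_of_commute_of {X : Type*} {f : FreeGroup X} {a : X} (h : Commute f (.of a)) :
    ∃ m : ℤ, f = .of a ^ m := by
  classical
  exact exists_eq_zpow_of_commute h (χ := expSum a) (by simp [expSum_of])

lemma eq_one_of_commute_of_of {X : Type*} {f : FreeGroup X} {a b : X} (hab : a ≠ b)
    (ha : Commute f (.of a)) (hb : Commute f (.of b)) : f = 1 := by
  classical
  obtain ⟨m, hm⟩ := exists_eq_zpow_of_commute_of ha
  obtain ⟨l, hl⟩ := exists_eq_zpow_of_commute_of hb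
  have := congrArg (expSum b) (hm.symm.trans hl)
  rw [map_zpow, map_zpow, expSum_of, expSum_of, if_neg hab, if_pos rfl, one_zpow] at this
  have hl0 : l = 0 := by
    have := congrArg Multiplicative.toAdd this
    simpa using this.symm
  rw [hl, hl0, zpow_zero]

end FreeGroup

section Equivariance

lemma equivariant_of_closure {N Q Γ : Type*} [Group N] [Group Q] [Group Γ] (ψ : Q →* MulAut N)
    (f : N →* Γ) (k : Q →* Γ) {S : Set Q} (hS : Subgroup.closure S = ⊤)
    (h : ∀ q ∈ S, ∀ x, f (ψ q x) = k q * f x * (k q)⁻¹) (q : Q) (x : N) :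
    f (ψ q x) = k q * f x * (k q)⁻¹ := by
  have hq : q ∈ Subgroup.closure S := hS ▸ Subgroup.mem_top q
  induction hq using Subgroup.closure_induction generalizing x with
  | mem q hq => exact h q hq x
  | one => simp
  | mul a b _ _ iha ihb => rw [map_mul, MulAut.mul_apply, iha, ihb, map_mul]; group
  | inv a _ ih =>
    have := ih (ψ a⁻¹ x)
    rw [← MulAut.mul_apply, ← map_mul, mul_inv_cancel, map_one, MulAut.one_apply] at this
    rw [this, map_inv k]
    group

lemma equivariant_free_of_closure {Q Γ X : Type*} [Group Q] [Group Γ]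
    (ψ : Q →* MulAut (FreeGroup X)) (f : FreeGroup X →* Γ) (k : Q →* Γ) {S : Set Q}
    (hS : Subgroup.closure S = ⊤)
    (h : ∀ q ∈ S, ∀ j, f (ψ q (.of j)) = k q * f (.of j) * (k q)⁻¹) (q : Q) (x : FreeGroup X) :
    f (ψ q x) = k q * f x * (k q)⁻¹ := by
  refine equivariant_of_closure ψ f k hS (fun q hq => ?_) q x
  have : f.comp (ψ q).toMonoidHom = (MulAut.conj (k q)).toMonoidHom.comp f :=
    FreeGroup.ext_hom _ _ fun j => by simpa using h q hq j
  exact fun x => by simpa using DFunLike.congr_fun this x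

end Equivariance

section BraidGroup

/-- The sequence `σ` satisfies the relations of the braid group on `n` strands; only the
terms `σ i` with `i + 1 < n` are nontrivial. -/
structure IsBraid {Γ : Type*} [Group Γ] (n : ℕ) (σ : ℕ → Γ) : Prop where
  comm : ∀ i j, i + 2 ≤ j → Commute (σ i) (σ j)
  braid : ∀ i, i + 2 < n → σ i * σ (i + 1) * σ i = σ (i + 1) * σ i * σ (i + 1)
  triv : ∀ i, n ≤ i + 1 → σ i = 1

lemma IsBraid.truncate {Γ : Type*} [Group Γ] {n : ℕ} {σ : ℕ → Γ}
    (comm : ∀ i j, i + 2 ≤ j → j + 1 < n → Commute (σ i) (σ j))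
    (braid : ∀ i, i + 2 < n → σ i * σ (i + 1) * σ i = σ (i + 1) * σ i * σ (i + 1)) :
    IsBraid n fun i => if i + 1 < n then σ i else 1 where
  comm i j h := by
    split_ifs with h1 h2
    · exact comm i j h h2
    all_goals simp
  braid i h := by
    simp only [show i + 1 < n by omega, show i + 1 + 1 < n by omega, if_true]
    exact braid i h
  triv i h := if_neg (by omega)

/-- The relators of the braid group on `n` strands, on generators indexed by `ℕ`. -/
def braidRels (n : ℕ) : Set (FreeGroup ℕ) :=
  {r | (∃ i j, i + 2 ≤ j ∧ r = .of i * .of j * (.of j * .of i)⁻¹) ∨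
    (∃ i, i + 2 < n ∧
      r = .of i * .of (i + 1) * .of i * (.of (i + 1) * .of i * .of (i + 1))⁻¹) ∨
    ∃ i, n ≤ i + 1 ∧ r = .of i}

/-- The braid group on `n` strands. -/
abbrev BraidGroup (n : ℕ) : Type := PresentedGroup (braidRels n)

namespace BraidGroup

variable {n : ℕ}

/-- The standard generators of the braid group. -/
def gen (n i : ℕ) : BraidGroup n := PresentedGroup.of i

lemma isBraid_gen (n : ℕ) : IsBraid n (gen n) where
  comm i j h := mul_inv_eq_one.1
    (PresentedGroup.one_of_mem (rels := braidRels n) (Or.inl ⟨i, j, h, rfl⟩))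
  braid i h := mul_inv_eq_one.1
    (PresentedGroup.one_of_mem (rels := braidRels n) (Or.inr (Or.inl ⟨i, h, rfl⟩)))
  triv i h := PresentedGroup.one_of_mem (rels := braidRels n) (Or.inr (Or.inr ⟨i, h, rfl⟩))

variable {Γ : Type*} [Group Γ]

/-- The universal property of the braid group. -/
def lift {σ : ℕ → Γ} (h : IsBraid n σ) : BraidGroup n →* Γ :=
  PresentedGroup.toGroup (f := σ) (by
    rintro r (⟨i, j, hij, rfl⟩ | ⟨i, hi, rfl⟩ | ⟨i, hi, rfl⟩)
    · simpa only [map_mul, map_inv, FreeGroup.lift_apply_of, mul_inv_eq_one] using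
        (h.comm i j hij).eq
    · simpa only [map_mul, map_inv, FreeGroup.lift_apply_of, mul_inv_eq_one] using h.braid i hi
    · simpa using h.triv i hi)

@[simp]
lemma lift_gen {σ : ℕ → Γ} (h : IsBraid n σ) (i : ℕ) : lift h (gen n i) = σ i :=
  PresentedGroup.toGroup.of _

lemma closure_gen (n : ℕ) : Subgroup.closure {g | ∃ i, i + 1 < n ∧ g = gen n i} = ⊤ := by
  rw [eq_top_iff, ← PresentedGroup.closure_range_of (braidRels n), Subgroup.closure_le]
  rintro _ ⟨i, rfl⟩
  by_cases h : i + 1 < n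
  · exact Subgroup.subset_closure ⟨i, h, rfl⟩
  · have : (PresentedGroup.of i : BraidGroup n) = 1 := (isBraid_gen n).triv i (by omega)
    rw [this]
    exact one_mem _

lemma gen_induction {P : BraidGroup n → Prop} (gen : ∀ i, i + 1 < n → P (gen n i)) (one : P 1)
    (mul : ∀ a b, P a → P b → P (a * b)) (inv : ∀ a, P a → P a⁻¹) (g : BraidGroup n) : P g := by
  have hg : g ∈ Subgroup.closure {g | ∃ i, i + 1 < n ∧ g = BraidGroup.gen n i} :=
    closure_gen n ▸ Subgroup.mem_top g
  induction hg using Subgroup.closure_induction with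
  | mem g hg => obtain ⟨i, hi, rfl⟩ := hg; exact gen i hi
  | one => exact one
  | mul a b _ _ ha hb => exact mul a b ha hb
  | inv a _ ha => exact inv a ha

end BraidGroup

/-- The automorphism of a free group given by the Artin action of a braid generator. -/
def artinAut (i : ℕ) : MulAut (FreeGroup ℕ) :=
  MonoidHom.toMulEquiv
    (FreeGroup.lift fun j => if j = i then .of (i + 1) else
      if j = i + 1 then (.of (i + 1))⁻¹ * .of i * .of (i + 1) else .of j)
    (FreeGroup.lift fun j => if j = i then .of i * .of (i + 1) * (.of i)⁻¹ else
      if j = i + 1 then .of i else .of j)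
    (by
      refine FreeGroup.ext_hom _ _ fun j => ?_
      by_cases h1 : j = i
      · subst h1; simp
      · by_cases h2 : j = i + 1
        · subst h2; simp [mul_assoc]
        · simp [h1, h2])
    (by
      refine FreeGroup.ext_hom _ _ fun j => ?_
      by_cases h1 : j = i
      · subst h1; simp [mul_assoc]
      · by_cases h2 : j = i + 1
        · subst h2; simp
        · simp [h1, h2])

lemma artinAut_self (i : ℕ) : artinAut i (.of i) = .of (i + 1) := by
  simp [artinAut, MonoidHom.toMulEquiv]

lemma artinAut_succ (i : ℕ) :
    artinAut i (.of (i + 1)) = (.of (i + 1))⁻¹ * .of i * .of (i + 1) := by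
  simp [artinAut, MonoidHom.toMulEquiv]

lemma artinAut_other {i j : ℕ} (h1 : j ≠ i) (h2 : j ≠ i + 1) : artinAut i (.of j) = .of j := by
  simp [artinAut, MonoidHom.toMulEquiv, h1, h2]

lemma mulAut_freeGroup_ext {X : Type*} {f g : MulAut (FreeGroup X)}
    (h : ∀ j, f (.of j) = g (.of j)) : f = g := by
  have : f.toMonoidHom = g.toMonoidHom := FreeGroup.ext_hom _ _ h
  exact MulEquiv.ext fun x => DFunLike.congr_fun this x

lemma isBraid_artinAut (n : ℕ) : IsBraid n fun i => if i + 1 < n then artinAut i else 1 := by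
  refine IsBraid.truncate (fun i j h _ => mulAut_freeGroup_ext fun k => ?_)
    fun i _ => mulAut_freeGroup_ext fun k => ?_
  · rw [MulAut.mul_apply, MulAut.mul_apply]
    by_cases h1 : k = i
    · subst h1
      rw [artinAut_self, artinAut_other (i := j) (by omega) (by omega), artinAut_self,
        artinAut_other (by omega) (by omega)]
    by_cases h2 : k = i + 1
    · subst h2
      rw [artinAut_succ, artinAut_other (i := j) (by omega) (by omega), artinAut_succ]
      simp only [map_mul, map_inv]
      rw [artinAut_other (i := j) (by omega) (by omega),
        artinAut_other (i := j) (by omega) (by omega)]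
    rw [artinAut_other h1 h2]
    by_cases h3 : k = j
    · subst h3
      rw [artinAut_self, artinAut_other (by omega) (by omega)]
    by_cases h4 : k = j + 1
    · subst h4
      rw [artinAut_succ]
      simp only [map_mul, map_inv]
      rw [artinAut_other (i := i) (by omega) (by omega),
        artinAut_other (i := i) (by omega) (by omega)]
    rw [artinAut_other h3 h4, artinAut_other h1 h2]
  · have e1 : artinAut i (.of (i + 1 + 1)) = .of (i + 1 + 1) :=
      artinAut_other (by omega) (by omega)
    have e2 : artinAut (i + 1) (.of i) = .of i := artinAut_other (by omega) (by omega)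
    simp only [MulAut.mul_apply]
    by_cases h1 : k = i
    · subst h1
      simp only [artinAut_self, e1, e2]
    by_cases h2 : k = i + 1
    · subst h2
      simp only [artinAut_self, artinAut_succ, e1, e2, map_mul, map_inv]
    by_cases h3 : k = i + 1 + 1
    · subst h3
      simp only [artinAut_self, artinAut_succ, e1, e2, map_mul, map_inv]
      group
    simp only [artinAut_other h1 h2, artinAut_other h2 h3]

namespace BraidGroup

variable {n : ℕ}

/-- The Artin action of the braid group on a free group. -/
def act (n : ℕ) : BraidGroup n →* MulAut (FreeGroup ℕ) := lift (isBraid_artinAut n)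

lemma act_gen {i : ℕ} (hi : i + 1 < n) : act n (gen n i) = artinAut i := by
  rw [act, lift_gen, if_pos hi]

lemma isBraid_swap (n : ℕ) :
    IsBraid n fun i => if i + 1 < n then Equiv.swap i (i + 1) else 1 := by
  refine IsBraid.truncate (fun i j h _ => ?_) fun i _ => ?_
  · refine (Equiv.Perm.disjoint_swap_swap ?_).commute
    simp; omega
  · ext k
    simp only [Equiv.Perm.mul_apply, Equiv.swap_apply_def]
    split_ifs <;> omega

/-- The permutation of the strands underlying a braid. -/
def perm (n : ℕ) : BraidGroup n →* Equiv.Perm ℕ := lift (isBraid_swap n)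

lemma perm_gen {i : ℕ} (hi : i + 1 < n) : perm n (gen n i) = Equiv.swap i (i + 1) := by
  rw [perm, lift_gen, if_pos hi]

lemma isConj_act (g : BraidGroup n) :
    ∀ j, IsConj (act n g (.of j)) (.of (perm n g j)) := by
  induction g using gen_induction with
  | gen i hi =>
    intro j
    rw [act_gen hi, perm_gen hi]
    by_cases h1 : j = i
    · subst h1
      rw [artinAut_self, Equiv.swap_apply_left]
    by_cases h2 : j = i + 1
    · subst h2
      rw [artinAut_succ, Equiv.swap_apply_right]
      exact isConj_iff.2 ⟨.of (i + 1), by group⟩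
    rw [artinAut_other h1 h2, Equiv.swap_apply_of_ne_of_ne h1 h2]
  | one => intro j; rw [map_one, map_one]; exact IsConj.refl _
  | mul a b ha hb =>
    intro j
    rw [map_mul, map_mul, MulAut.mul_apply, Equiv.Perm.mul_apply]
    exact ((act n a).toMonoidHom.map_isConj (hb j)).trans (ha _)
  | inv a ha =>
    rw [map_inv, map_inv]
    exact isConj_inv ha

lemma act_of_ge (g : BraidGroup n) {j : ℕ} (hj : n ≤ j) : act n g (.of j) = .of j := by
  induction g using gen_induction with
  | gen i hi => rw [act_gen hi, artinAut_other (by omega) (by omega)]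
  | one => simp
  | mul a b ha hb => rw [map_mul, MulAut.mul_apply, hb, ha]
  | inv a ha =>
    conv_lhs => rw [← ha]
    rw [map_inv, MulAut.inv_apply_self]

lemma perm_of_ge (g : BraidGroup n) {j : ℕ} (hj : n ≤ j) : perm n g j = j := by
  induction g using gen_induction with
  | gen i hi => rw [perm_gen hi, Equiv.swap_apply_of_ne_of_ne (by omega) (by omega)]
  | one => simp
  | mul a b ha hb => rw [map_mul, Equiv.Perm.mul_apply, hb, ha]
  | inv a ha =>
    conv_lhs => rw [← ha]
    rw [map_inv, ← Equiv.Perm.mul_apply, inv_mul_cancel, Equiv.Perm.one_apply]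

lemma perm_lt (g : BraidGroup n) {j : ℕ} (hj : j < n) : perm n g j < n := by
  by_contra h
  have := perm_of_ge g⁻¹ (not_lt.1 h)
  rw [map_inv, ← Equiv.Perm.mul_apply, inv_mul_cancel, Equiv.Perm.one_apply] at this
  omega

end BraidGroup

/-- The product of the first `n` generators of a free group. -/
def genProd : ℕ → FreeGroup ℕ
  | 0 => 1
  | n + 1 => genProd n * .of n

lemma artinAut_genProd_of_le {i m : ℕ} (h : m ≤ i) : artinAut i (genProd m) = genProd m := by
  induction m with
  | zero => exact map_one _
  | succ m ih => rw [genProd, map_mul, ih (by omega), artinAut_other (by omega) (by omega)]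

lemma artinAut_genProd {i m : ℕ} (h : i + 2 ≤ m) : artinAut i (genProd m) = genProd m := by
  induction m, h using Nat.le_induction with
  | base =>
    rw [genProd, genProd, map_mul, map_mul, artinAut_genProd_of_le le_rfl, artinAut_self,
      artinAut_succ]
    group
  | succ m h ih => rw [genProd, map_mul, ih, artinAut_other (by omega) (by omega)]

lemma BraidGroup.act_genProd {n : ℕ} (g : BraidGroup n) : act n g (genProd n) = genProd n := by
  induction g using gen_induction with
  | gen i hi => rw [act_gen hi, artinAut_genProd (by omega)]
  | one => simp
  | mul a b ha hb => rw [map_mul, MulAut.mul_apply, hb, ha]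
  | inv a ha =>
    conv_lhs => rw [← ha]
    rw [map_inv, MulAut.inv_apply_self]

end BraidGroup

section BraidSystem

variable {Γ : Type*} [Group Γ] {n : ℕ} {σ x : ℕ → Γ}

/-- The sequence `σ` satisfies the braid relations and acts by conjugation on the sequence `x` by
the formulas of the Artin action. -/
structure IsBraidSystem (n : ℕ) (σ x : ℕ → Γ) : Prop extends IsBraid n σ where
  conj_self : ∀ i, i + 1 < n → σ i * x i * (σ i)⁻¹ = x (i + 1)
  conj_prod : ∀ i, i + 1 < n → Commute (σ i) (x i * x (i + 1))
  conj_other : ∀ i j, i + 1 < n → j ≠ i → j ≠ i + 1 → Commute (σ i) (x j)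

lemma IsBraidSystem.conj_succ (h : IsBraidSystem n σ x) {i : ℕ} (hi : i + 1 < n) :
    σ i * x (i + 1) * (σ i)⁻¹ = (x (i + 1))⁻¹ * x i * x (i + 1) := by
  have h1 := h.conj_self i hi
  have h2 := (h.conj_prod i hi).eq
  calc σ i * x (i + 1) * (σ i)⁻¹ =
      (σ i * x i * (σ i)⁻¹)⁻¹ * (σ i * (x i * x (i + 1))) * (σ i)⁻¹ := by group
    _ = _ := by rw [h1, h2]; group

/-- The semidirect product of a free group and the braid group on `n` strands. -/
abbrev FreeBraid (n : ℕ) : Type := FreeGroup ℕ ⋊[BraidGroup.act n] BraidGroup n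

namespace FreeBraid

/-- The free generators. -/
def pt (n i : ℕ) : FreeBraid n := SemidirectProduct.inl (.of i)

/-- The braid generators. -/
def br (n i : ℕ) : FreeBraid n := SemidirectProduct.inr (BraidGroup.gen n i)

lemma br_conj_pt {i : ℕ} (hi : i + 1 < n) (w : FreeGroup ℕ) :
    br n i * SemidirectProduct.inl w * (br n i)⁻¹ = SemidirectProduct.inl (artinAut i w) := by
  rw [← BraidGroup.act_gen hi, SemidirectProduct.inl_aut, map_inv]; rfl

lemma isBraidSystem (n : ℕ) : IsBraidSystem n (br n) (pt n) where
  comm i j h := ((BraidGroup.isBraid_gen n).comm i j h).map SemidirectProduct.inr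
  braid i h := by
    simp only [br, ← map_mul]
    rw [(BraidGroup.isBraid_gen n).braid i h]
  triv i h := by rw [br, (BraidGroup.isBraid_gen n).triv i h, map_one]
  conj_self i h := by rw [pt, br_conj_pt h, artinAut_self]; rfl
  conj_prod i h := by
    rw [Commute, SemiconjBy, ← mul_inv_eq_iff_eq_mul, pt, pt, ← map_mul, br_conj_pt h, map_mul,
      artinAut_self, artinAut_succ]
    group
  conj_other i j h h1 h2 := by
    rw [Commute, SemiconjBy, ← mul_inv_eq_iff_eq_mul, pt, br_conj_pt h, artinAut_other h1 h2]

/-- The universal property of `FreeBraid n`. -/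
def lift (h : IsBraidSystem n σ x) : FreeBraid n →* Γ :=
  SemidirectProduct.lift (FreeGroup.lift x) (BraidGroup.lift h.toIsBraid) fun g =>
    MonoidHom.ext fun w => by
      simpa using equivariant_free_of_closure (BraidGroup.act n) (FreeGroup.lift x)
        (BraidGroup.lift h.toIsBraid) (BraidGroup.closure_gen n) (by
          rintro _ ⟨i, hi, rfl⟩ j
          rw [BraidGroup.act_gen hi, BraidGroup.lift_gen]
          by_cases h1 : j = i
          · subst h1
            rw [artinAut_self, FreeGroup.lift_apply_of, FreeGroup.lift_apply_of, h.conj_self j hi]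
          by_cases h2 : j = i + 1
          · subst h2
            rw [artinAut_succ, FreeGroup.lift_apply_of, h.conj_succ hi]
            simp
          · rw [artinAut_other h1 h2, FreeGroup.lift_apply_of, (h.conj_other i j hi h1 h2).eq,
              mul_inv_cancel_right]) g w

@[simp]
lemma lift_pt (h : IsBraidSystem n σ x) (i : ℕ) : lift h (pt n i) = x i := by
  rw [lift, pt, SemidirectProduct.lift_inl, FreeGroup.lift_apply_of]

@[simp]
lemma lift_br (h : IsBraidSystem n σ x) (i : ℕ) : lift h (br n i) = σ i := by
  rw [lift, br, SemidirectProduct.lift_inr, BraidGroup.lift_gen]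

lemma closure_gen (n : ℕ) :
    Subgroup.closure {g | (∃ i, i + 1 < n ∧ g = br n i) ∨ ∃ i, g = pt n i} = ⊤ := by
  set K := Subgroup.closure {g | (∃ i, i + 1 < n ∧ g = br n i) ∨ ∃ i, g = pt n i} with hK
  have h1 : ∀ b, (SemidirectProduct.inr b : FreeBraid n) ∈ K := by
    intro b
    induction b using BraidGroup.gen_induction with
    | gen i hi => exact Subgroup.subset_closure (Or.inl ⟨i, hi, rfl⟩)
    | one => rw [map_one]; exact one_mem _
    | mul a b ha hb => rw [map_mul]; exact mul_mem ha hb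
    | inv a ha => rw [map_inv]; exact inv_mem ha
  have h2 : ∀ w, (SemidirectProduct.inl w : FreeBraid n) ∈ K := by
    intro w
    induction w using FreeGroup.induction_on with
    | C1 => rw [map_one]; exact one_mem _
    | of i => exact Subgroup.subset_closure (Or.inr ⟨i, rfl⟩)
    | inv_of i h => rw [map_inv]; exact inv_mem h
    | mul a b ha hb => rw [map_mul]; exact mul_mem ha hb
  rw [eq_top_iff]
  rintro g -
  rw [← SemidirectProduct.inl_left_mul_inr_right g]
  exact mul_mem (h2 _) (h1 _)

end FreeBraid

/-- The sequence obtained from `a` by successive conjugation by the terms of `σ`. -/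
def conjSeq (n : ℕ) (σ : ℕ → Γ) (a : Γ) : ℕ → Γ
  | 0 => a
  | i + 1 => if i + 1 < n then σ i * conjSeq n σ a i * (σ i)⁻¹ else 1

lemma conjSeq_succ (a : Γ) {i : ℕ} (h : i + 1 < n) :
    conjSeq n σ a (i + 1) = σ i * conjSeq n σ a i * (σ i)⁻¹ := if_pos h

lemma conjSeq_of_ge (a : Γ) {i : ℕ} (h : n ≤ i) (h0 : i ≠ 0) : conjSeq n σ a i = 1 := by
  obtain ⟨i, rfl⟩ := Nat.exists_eq_succ_of_ne_zero h0
  exact if_neg (by omega)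

lemma commute_conj {a b g : Γ} (h : Commute a b) : Commute (g * a * g⁻¹) (g * b * g⁻¹) := by
  simpa using h.map (MulAut.conj g).toMonoidHom

lemma IsBraid.commute' (h : IsBraid n σ) {i j : ℕ} (hij : i + 2 ≤ j ∨ j + 2 ≤ i) :
    Commute (σ i) (σ j) :=
  hij.elim (h.comm i j) fun h' => (h.comm j i h').symm

lemma isBraidSystem_conjSeq (h : IsBraid n σ) {a : Γ}
    (ha : ∀ i, 1 ≤ i → i + 1 < n → Commute (σ i) a)
    (h4 : 1 < n → σ 0 * a * σ 0 * a = a * σ 0 * a * σ 0) :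
    IsBraidSystem n σ (conjSeq n σ a) := by
  have hlt : ∀ j i, j < i → i + 1 < n → Commute (σ i) (conjSeq n σ a j) := by
    intro j
    induction j with
    | zero => exact fun i h1 h2 => ha i h1 h2
    | succ j ih =>
      intro i hij hi
      rw [conjSeq_succ a (by omega)]
      have hc := h.commute' (i := i) (j := j) (Or.inr (by omega))
      exact (hc.mul_right (ih i (by omega) hi)).mul_right hc.inv_right
  have hge : ∀ i j, i + 2 ≤ j → i + 1 < n → Commute (σ i) (conjSeq n σ a j) := by
    intro i j hij hi
    induction j, hij using Nat.le_induction with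
    | base =>
      by_cases hn : i + 2 < n
      · rw [conjSeq_succ a (by omega), conjSeq_succ a hi]
        have hb := h.braid i hn
        have e1 : (σ (i + 1) * σ i) * σ (i + 1) * (σ (i + 1) * σ i)⁻¹ = σ i := by
          rw [mul_inv_eq_iff_eq_mul, ← mul_assoc, hb]
        have := commute_conj (g := σ (i + 1) * σ i) (hlt i (i + 1) (by omega) (by omega))
        rw [e1] at this
        convert this using 1
        group
      · rw [conjSeq_of_ge a (by omega) (by omega)]
        exact Commute.one_right _
    | succ j hij ih =>
      by_cases hn : j + 1 < n
      · rw [conjSeq_succ a hn]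
        have hc := h.comm i j hij
        exact (hc.mul_right ih).mul_right hc.inv_right
      · rw [conjSeq_of_ge a (by omega) (by omega)]
        exact Commute.one_right _
  refine { h with conj_self := ?_, conj_prod := ?_, conj_other := ?_ }
  · exact fun i hi => (conjSeq_succ a hi).symm
  · intro i
    induction i with
    | zero =>
      intro hi
      rw [conjSeq_succ a hi]
      have h4' := h4 (by omega)
      change σ 0 * (a * (σ 0 * a * (σ 0)⁻¹)) = (a * (σ 0 * a * (σ 0)⁻¹)) * σ 0
      calc _ = (σ 0 * a * σ 0 * a) * (σ 0)⁻¹ := by group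
        _ = _ := by rw [h4']; group
    | succ i ih =>
      intro hi
      have hb := h.braid i (by omega)
      have e1 : (σ i * σ (i + 1)) * σ i * (σ i * σ (i + 1))⁻¹ = σ (i + 1) := by
        rw [mul_inv_eq_iff_eq_mul, ← mul_assoc, hb]
      have e2 : (σ i * σ (i + 1)) * conjSeq n σ a i * (σ i * σ (i + 1))⁻¹ =
          conjSeq n σ a (i + 1) := by
        rw [mul_assoc (σ i), (hlt i (i + 1) (by omega) hi).eq, conjSeq_succ a (by omega)]
        group
      have e3 : (σ i * σ (i + 1)) * conjSeq n σ a (i + 1) * (σ i * σ (i + 1))⁻¹ =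
          conjSeq n σ a (i + 1 + 1) := by
        have : σ i * conjSeq n σ a (i + 1 + 1) * (σ i)⁻¹ = conjSeq n σ a (i + 1 + 1) := by
          rw [(hge i (i + 2) le_rfl (by omega)).eq, mul_inv_cancel_right]
        conv_rhs => rw [← this, conjSeq_succ a hi]
        group
      have := commute_conj (g := σ i * σ (i + 1)) (ih (by omega))
      rwa [e1, ← conj_mul, e2, e3] at this
  · intro i j hi h1 h2
    rcases lt_or_gt_of_ne h1 with h3 | h3
    · exact hlt j i h3 hi
    · exact hge i j (by omega) hi

end BraidSystem

section Wreath

variable {Γ : Type*} [Group Γ] {m : ℕ} {τ x : ℕ → Γ}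

/-- The coefficients of the monomial representation of the braid group on `m + 1` strands
attached to a braid system on `m` strands. -/
def monoCoeff (m : ℕ) (τ x : ℕ → Γ) (i j : ℕ) : Γ :=
  if j < i then τ (i - 1) else if j = i then 1 else if j = i + 1 then x i else
    if j ≤ m then τ i else 1

/-- The monomial permutation by which a braid generator acts. -/
def monoPerm (m : ℕ) (τ x : ℕ → Γ) (i : ℕ) : Equiv.Perm (Γ × ℕ) where
  toFun p := (monoCoeff m τ x i p.2 * p.1, Equiv.swap i (i + 1) p.2)
  invFun p := ((monoCoeff m τ x i (Equiv.swap i (i + 1) p.2))⁻¹ * p.1, Equiv.swap i (i + 1) p.2)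
  left_inv p := by simp
  right_inv p := by simp

lemma monoPerm_apply (i : ℕ) (h : Γ) (j : ℕ) :
    monoPerm m τ x i (h, j) = (monoCoeff m τ x i j * h, Equiv.swap i (i + 1) j) := rfl

lemma monoPerm_lt {i j : ℕ} (hij : j < i) (h : Γ) :
    monoPerm m τ x i (h, j) = (τ (i - 1) * h, j) := by
  rw [monoPerm_apply, monoCoeff, if_pos hij, Equiv.swap_apply_of_ne_of_ne (by omega) (by omega)]

lemma monoPerm_self (i : ℕ) (h : Γ) : monoPerm m τ x i (h, i) = (h, i + 1) := by
  rw [monoPerm_apply, monoCoeff, if_neg (by omega), if_pos rfl, Equiv.swap_apply_left, one_mul]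

lemma monoPerm_succ (i : ℕ) (h : Γ) : monoPerm m τ x i (h, i + 1) = (x i * h, i) := by
  rw [monoPerm_apply, monoCoeff, if_neg (by omega), if_neg (by omega), if_pos rfl,
    Equiv.swap_apply_right]

lemma monoPerm_gt {i j : ℕ} (hij : i + 1 < j) (hj : j ≤ m) (h : Γ) :
    monoPerm m τ x i (h, j) = (τ i * h, j) := by
  rw [monoPerm_apply, monoCoeff, if_neg (by omega), if_neg (by omega), if_neg (by omega),
    if_pos hj, Equiv.swap_apply_of_ne_of_ne (by omega) (by omega)]

lemma monoPerm_out {i j : ℕ} (hij : i + 1 < j) (hj : m < j) (h : Γ) :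
    monoPerm m τ x i (h, j) = (h, j) := by
  rw [monoPerm_apply, monoCoeff, if_neg (by omega), if_neg (by omega), if_neg (by omega),
    if_neg (by omega), Equiv.swap_apply_of_ne_of_ne (by omega) (by omega), one_mul]

lemma monoPerm_comm (hs : IsBraidSystem m τ x) {i k : ℕ} (hik : i + 2 ≤ k) (hk : k < m) :
    Commute (monoPerm m τ x i) (monoPerm m τ x k) := by
  refine Equiv.ext fun ⟨h, j⟩ => ?_
  rw [Equiv.Perm.mul_apply, Equiv.Perm.mul_apply]
  rcases lt_trichotomy j i with h1 | rfl | h1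
  · have h2 : j < k := by omega
    simp only [monoPerm_lt h1, monoPerm_lt h2, ← mul_assoc, (hs.comm (i - 1) (k - 1) (by omega)).eq]
  · have h1 : j < k := by omega
    have h2 : j + 1 < k := by omega
    simp only [monoPerm_lt h1, monoPerm_lt h2, monoPerm_self]
  obtain rfl | h2 : j = i + 1 ∨ i + 1 < j := by omega
  · have h2 : i < k := by omega
    have h3 : i + 1 < k := by omega
    simp only [monoPerm_lt h2, monoPerm_lt h3, monoPerm_succ, ← mul_assoc,
      (hs.conj_other (k - 1) i (by omega) (by omega) (by omega)).eq]
  rcases lt_trichotomy j k with h3 | rfl | h3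
  · have h4 : j ≤ m := by omega
    simp only [monoPerm_lt h3, monoPerm_gt h2 h4, ← mul_assoc, (hs.comm i (k - 1) (by omega)).eq]
  · have h3 : i + 1 < j + 1 := by omega
    have h4 : j + 1 ≤ m := by omega
    simp only [monoPerm_self, monoPerm_gt h2 hk.le, monoPerm_gt h3 h4]
  obtain rfl | h4 : j = k + 1 ∨ k + 1 < j := by omega
  · have h3 : i + 1 < k := by omega
    have h4 : k + 1 ≤ m := by omega
    simp only [monoPerm_succ, monoPerm_gt h2 h4, monoPerm_gt h3 hk.le, ← mul_assoc,
      (hs.conj_other i k (by omega) (by omega) (by omega)).eq]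
  by_cases h5 : j ≤ m
  · simp only [monoPerm_gt h4 h5, monoPerm_gt h2 h5, ← mul_assoc, (hs.comm i k hik).eq]
  · simp only [monoPerm_out h4 (not_le.1 h5), monoPerm_out h2 (not_le.1 h5)]

lemma monoPerm_braid (hs : IsBraidSystem m τ x) {i : ℕ} (hi : i + 1 < m) :
    monoPerm m τ x i * monoPerm m τ x (i + 1) * monoPerm m τ x i =
      monoPerm m τ x (i + 1) * monoPerm m τ x i * monoPerm m τ x (i + 1) := by
  refine Equiv.ext fun ⟨h, j⟩ => ?_
  simp only [Equiv.Perm.mul_apply]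
  rcases lt_trichotomy j i with h1 | rfl | h1
  · obtain ⟨i, rfl⟩ := Nat.exists_eq_succ_of_ne_zero (show i ≠ 0 by omega)
    have hb := hs.braid i (by omega)
    simp only [monoPerm_lt h1, monoPerm_lt (show j < i.succ + 1 by omega), Nat.succ_eq_add_one,
      Nat.add_sub_cancel, ← mul_assoc, hb]
  · have h1 : j + 1 < j + 1 + 1 := by omega
    have h2 : j < j + 1 := by omega
    have h3 : j + 1 + 1 ≤ m := by omega
    simp only [monoPerm_self, monoPerm_gt h1 h3, monoPerm_lt h2, Nat.add_sub_cancel]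
  obtain rfl | h2 : j = i + 1 ∨ i + 1 < j := by omega
  · have h1 : i < i + 1 := by omega
    have h2 : i + 1 < i + 1 + 1 := by omega
    have h3 : i + 1 + 1 ≤ m := by omega
    simp only [monoPerm_succ, monoPerm_lt h1, monoPerm_self, monoPerm_gt h2 h3, ← mul_assoc,
      ← hs.conj_self i hi, Nat.add_sub_cancel, inv_mul_cancel_right]
  obtain rfl | h3 : j = i + 1 + 1 ∨ i + 1 + 1 < j := by omega
  · have h1 : i < i + 1 := by omega
    have h3 : i + 1 + 1 ≤ m := by omega
    simp only [monoPerm_succ, monoPerm_gt h2 h3, monoPerm_lt h1, Nat.add_sub_cancel, ← mul_assoc]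
    rw [mul_assoc (τ i), (hs.conj_prod i hi).eq]
  by_cases h5 : j ≤ m
  · simp only [monoPerm_gt h3 h5, monoPerm_gt h2 h5, ← mul_assoc]
    rw [hs.braid i (by omega)]
  · simp only [monoPerm_out h3 (not_le.1 h5), monoPerm_out h2 (not_le.1 h5)]

/-- The monomial representation attached to a braid system. -/
def monoRep (hs : IsBraidSystem m τ x) : BraidGroup (m + 1) →* Equiv.Perm (Γ × ℕ) :=
  BraidGroup.lift (n := m + 1)
    (IsBraid.truncate (fun _ _ h1 h2 => monoPerm_comm hs h1 (by omega))
      fun _ h => monoPerm_braid hs (by omega))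

lemma monoRep_gen (hs : IsBraidSystem m τ x) {i : ℕ} (hi : i < m) :
    monoRep hs (BraidGroup.gen (m + 1) i) = monoPerm m τ x i := by
  rw [monoRep, BraidGroup.lift_gen, if_pos (by omega)]

lemma monoRep_aux (hs : IsBraidSystem m τ x) (g : BraidGroup (m + 1)) (h : Γ) (j : ℕ) :
    monoRep hs g (h, j) = ((monoRep hs g (1, j)).1 * h, BraidGroup.perm (m + 1) g j) := by
  induction g using BraidGroup.gen_induction generalizing h j with
  | gen i hi =>
    rw [monoRep_gen hs (by omega), BraidGroup.perm_gen hi, monoPerm_apply, monoPerm_apply, mul_one]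
  | one => simp
  | mul a b ha hb =>
    rw [map_mul, map_mul, Equiv.Perm.mul_apply, Equiv.Perm.mul_apply, Equiv.Perm.mul_apply, hb, ha,
      hb 1, ha (_ * 1), mul_one, mul_assoc]
  | inv a ha =>
    have key : ∀ h, monoRep hs a⁻¹ (h, j) =
        ((monoRep hs a (1, (BraidGroup.perm (m + 1) a)⁻¹ j)).1⁻¹ * h,
          BraidGroup.perm (m + 1) a⁻¹ j) := by
      intro h
      rw [map_inv, Equiv.Perm.inv_eq_iff_eq, ha, map_inv, mul_inv_cancel_left,
        ← Equiv.Perm.mul_apply, mul_inv_cancel, Equiv.Perm.one_apply]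
    rw [key, key, mul_one]

/-- The cocycle given by the first coefficient of the monomial representation. -/
def monoCocycle (hs : IsBraidSystem m τ x) (g : BraidGroup (m + 1)) : Γ := (monoRep hs g (1, 0)).1

lemma monoRep_zero (hs : IsBraidSystem m τ x) {g : BraidGroup (m + 1)}
    (hg : BraidGroup.perm (m + 1) g 0 = 0) (h : Γ) :
    monoRep hs g (h, 0) = (monoCocycle hs g * h, 0) := by
  rw [monoRep_aux, hg]; rfl

lemma monoCocycle_mul (hs : IsBraidSystem m τ x) (a : BraidGroup (m + 1)) {b : BraidGroup (m + 1)}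
    (ha : BraidGroup.perm (m + 1) a 0 = 0) (hb : BraidGroup.perm (m + 1) b 0 = 0) :
    monoCocycle hs (a * b) = monoCocycle hs a * monoCocycle hs b := by
  rw [monoCocycle, map_mul, Equiv.Perm.mul_apply, monoRep_zero hs hb, monoRep_zero hs ha, mul_one]

lemma monoCocycle_one (hs : IsBraidSystem m τ x) : monoCocycle hs 1 = 1 := by
  rw [monoCocycle, map_one]; rfl

lemma perm_pow_zero {g : BraidGroup (m + 1)} (hg : BraidGroup.perm (m + 1) g 0 = 0) (k : ℕ) :
    BraidGroup.perm (m + 1) (g ^ k) 0 = 0 := by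
  induction k with
  | zero => simp
  | succ k ih => rw [pow_succ, map_mul, Equiv.Perm.mul_apply, hg, ih]

lemma monoCocycle_pow (hs : IsBraidSystem m τ x) {g : BraidGroup (m + 1)}
    (hg : BraidGroup.perm (m + 1) g 0 = 0) (k : ℕ) :
    monoCocycle hs (g ^ k) = monoCocycle hs g ^ k := by
  induction k with
  | zero => simpa using monoCocycle_one hs
  | succ k ih => rw [pow_succ, monoCocycle_mul hs _ (perm_pow_zero hg k) hg, ih, pow_succ]

lemma monoCocycle_gen_succ (hs : IsBraidSystem m τ x) {i : ℕ} (hi : i + 1 < m) :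
    monoCocycle hs (BraidGroup.gen (m + 1) (i + 1)) = τ i := by
  rw [monoCocycle, monoRep_gen hs hi, monoPerm_lt (by omega)]
  simp

lemma monoCocycle_gen_zero_sq (hs : IsBraidSystem m τ x) (hm : 0 < m) :
    monoCocycle hs (BraidGroup.gen (m + 1) 0 ^ 2) = x 0 := by
  rw [monoCocycle, map_pow, monoRep_gen hs hm, pow_two, Equiv.Perm.mul_apply, monoPerm_self,
    monoPerm_succ]
  simp

end Wreath

namespace BraidGroup

/-- The image of the braid system of `FreeBraid m` in the braid group on `m + 1` strands. -/
lemma isBraidSystem_incl (m : ℕ) : IsBraidSystem m (fun i => gen (m + 1) (i + 1))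
    (conjSeq m (fun i => gen (m + 1) (i + 1)) (gen (m + 1) 0 ^ 2)) := by
  have h := isBraid_gen (m + 1)
  refine isBraidSystem_conjSeq ⟨fun i j hij => h.comm _ _ (by omega),
    fun i hi => h.braid _ (by omega), fun i hi => h.triv _ (by omega)⟩
    (fun i h1 _ => (h.comm 0 (i + 1) (by omega)).symm.pow_right 2) fun hm => ?_
  have hb := h.braid 0 (by omega)
  set a := gen (m + 1) 0
  set b := gen (m + 1) (0 + 1)
  simp only [mul_assoc] at hb
  have hb' : ∀ c, a * (b * (a * c)) = b * (a * (b * c)) := fun c => by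
    simpa only [mul_assoc] using congrArg (· * c) hb
  simp only [pow_two, mul_assoc]
  rw [hb', ← hb', hb, ← hb']

/-- The embedding of `FreeBraid m` in the braid group on `m + 1` strands. -/
def incl (m : ℕ) : FreeBraid m →* BraidGroup (m + 1) := FreeBraid.lift (isBraidSystem_incl m)

lemma incl_br (m i : ℕ) : incl m (FreeBraid.br m i) = gen (m + 1) (i + 1) :=
  FreeBraid.lift_br _ _

lemma incl_pt_zero (m : ℕ) : incl m (FreeBraid.pt m 0) = gen (m + 1) 0 ^ 2 :=
  FreeBraid.lift_pt _ _

/-- The braid moving the first strand to position `j`. -/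
def shift (n : ℕ) : ℕ → BraidGroup n
  | 0 => 1
  | j + 1 => gen n j * shift n j

lemma gen_commute_shift (n : ℕ) {i j : ℕ} (h : j < i) : Commute (gen n i) (shift n j) := by
  induction j with
  | zero => exact Commute.one_right _
  | succ j ih => exact ((isBraid_gen n).comm j i (by omega)).symm.mul_right (ih (by omega))

lemma shift_mul_gen_succ {n i j : ℕ} (h : i + 2 ≤ j) (hj : j < n) :
    shift n j * gen n (i + 1) = gen n i * shift n j := by
  induction j, h using Nat.le_induction with
  | base =>
    rw [shift, shift, mul_assoc, mul_assoc, ← (gen_commute_shift n (by omega)).eq, ← mul_assoc,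
      ← mul_assoc, ← (isBraid_gen n).braid i (by omega)]
    group
  | succ j h ih =>
    rw [shift, mul_assoc, ih (by omega), ← mul_assoc, ← mul_assoc,
      ((isBraid_gen n).comm i j (by omega)).eq]

lemma shift_mul_incl_pt {m i : ℕ} (hi : i < m) :
    shift (m + 1) i * incl m (FreeBraid.pt m i) = gen (m + 1) i ^ 2 * shift (m + 1) i := by
  induction i with
  | zero => rw [shift, incl_pt_zero, one_mul, mul_one]
  | succ i ih =>
    have hb := (isBraid_gen (m + 1)).braid i (by omega)
    rw [← (FreeBraid.isBraidSystem m).conj_self i hi, map_mul, map_mul, map_inv, incl_br, shift]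
    have hc := gen_commute_shift (m + 1) (show i < i + 1 by omega)
    have ih := ih (by omega)
    set a := gen (m + 1) i
    set b := gen (m + 1) (i + 1)
    set t := shift (m + 1) i
    rw [← mul_assoc, mul_inv_eq_iff_eq_mul]
    calc a * t * (b * incl m (FreeBraid.pt m i)) = a * (t * b) * incl m (FreeBraid.pt m i) := by
          group
      _ = a * b * (t * incl m (FreeBraid.pt m i)) := by rw [← hc.eq]; group
      _ = (a * b * a) * a * t := by rw [ih, pow_two]; simp only [mul_assoc]
      _ = b * (a * b * a) * t := by conv_lhs => rw [hb, mul_assoc b, mul_assoc b]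
      _ = b ^ 2 * a * (b * t) := by rw [hb, pow_two]; simp only [mul_assoc]
      _ = b ^ 2 * (a * t) * b := by rw [hc.eq]; group

/-- The evaluation map intertwining the monomial representation with left multiplication. -/
def coset (m : ℕ) (p : FreeBraid m × ℕ) : BraidGroup (m + 1) := shift (m + 1) p.2 * incl m p.1

/-- The cocycle with values in `FreeBraid m`. -/
abbrev cocycle (m : ℕ) : BraidGroup (m + 1) → FreeBraid m := monoCocycle (FreeBraid.isBraidSystem m)

lemma coset_monoRep {m : ℕ} (g : BraidGroup (m + 1)) (p : FreeBraid m × ℕ) (hp : p.2 < m + 1) :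
    coset m (monoRep (FreeBraid.isBraidSystem m) g p) = g * coset m p := by
  induction g using gen_induction generalizing p with
  | gen i hi =>
    obtain ⟨h, j⟩ := p
    dsimp only at hp
    rw [monoRep_gen _ (by omega)]
    rcases lt_trichotomy j i with h1 | rfl | h1
    · rw [monoPerm_lt h1, coset, coset, map_mul, incl_br, Nat.sub_add_cancel (by omega),
        ← mul_assoc,
        ← mul_assoc, (gen_commute_shift (m + 1) h1).eq]
    · rw [monoPerm_self, coset, coset, shift, mul_assoc]
    obtain rfl | h2 : j = i + 1 ∨ i + 1 < j := by omega
    · rw [monoPerm_succ, coset, coset, map_mul, ← mul_assoc, shift_mul_incl_pt (by omega), shift,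
        pow_two]
      simp only [mul_assoc]
    · rw [monoPerm_gt h2 (by omega), coset, coset, map_mul, incl_br, ← mul_assoc,
        shift_mul_gen_succ h2 hp, mul_assoc]
  | one => simp
  | mul a b ha hb =>
    have : (monoRep (FreeBraid.isBraidSystem m) b p).2 < m + 1 := by
      rw [← Prod.mk.eta (p := p), monoRep_aux]; exact perm_lt b hp
    rw [map_mul, Equiv.Perm.mul_apply, ha _ this, hb _ hp, mul_assoc]
  | inv a ha =>
    have : (monoRep (FreeBraid.isBraidSystem m) a⁻¹ p).2 < m + 1 := by
      rw [← Prod.mk.eta (p := p), monoRep_aux]; exact perm_lt _ hp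
    have h := ha _ this
    rw [← Equiv.Perm.mul_apply, ← map_mul, mul_inv_cancel, map_one, Equiv.Perm.one_apply] at h
    rw [h, inv_mul_cancel_left]

lemma eq_incl_cocycle {m : ℕ} {g : BraidGroup (m + 1)} (hg : perm (m + 1) g 0 = 0) :
    g = incl m (cocycle m g) := by
  have := coset_monoRep g (1, 0) (by simp)
  rw [monoRep_zero _ hg] at this
  simpa [coset, shift] using this.symm

lemma perm_shift {n j : ℕ} (hj : j < n) : perm n (shift n j) 0 = j := by
  induction j with
  | zero => simp [shift]
  | succ j ih =>
    rw [shift, map_mul, Equiv.Perm.mul_apply, ih (by omega), perm_gen hj, Equiv.swap_apply_left]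

end BraidGroup

section Torsion

lemma eq_one_of_isOfFinOrder {G : Type*} [Group G]
    (h : ∀ p, p.Prime → ∀ g : G, g ^ p = 1 → g = 1) {g : G} (hg : IsOfFinOrder g) : g = 1 := by
  rw [← orderOf_eq_one_iff]
  by_contra hne
  obtain ⟨p, hp, k, hk⟩ := Nat.exists_prime_and_dvd hne
  have h1 : g ^ k = 1 := h p hp _ (by rw [← pow_mul, mul_comm, ← hk, pow_orderOf_eq_one])
  have h2 := orderOf_dvd_of_pow_eq_one h1
  have h3 := hg.orderOf_pos
  rw [hk] at h2 h3
  have h4 := Nat.le_of_dvd (Nat.pos_of_mul_pos_left h3) h2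
  nlinarith [hp.two_le, Nat.pos_of_mul_pos_left h3]

lemma semidirectProduct_torsionFree {N Q : Type*} [Group N] [Group Q] {φ : Q →* MulAut N}
    (hN : ∀ g : N, IsOfFinOrder g → g = 1) (hQ : ∀ g : Q, IsOfFinOrder g → g = 1)
    (g : N ⋊[φ] Q) (hg : IsOfFinOrder g) : g = 1 := by
  have h1 : g.right = 1 := hQ _ (SemidirectProduct.rightHom.isOfFinOrder hg)
  have h2 : g = SemidirectProduct.inl g.left := by
    rw [← SemidirectProduct.inl_left_mul_inr_right g, h1]; simp
  rw [h2] at hg ⊢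
  rw [hN _ ((SemidirectProduct.inl_injective.isOfFinOrder_iff
    (f := (SemidirectProduct.inl : N →* N ⋊[φ] Q))).1 hg), map_one]

lemma freeGroup_torsionFree {X : Type*} (g : FreeGroup X) (hg : IsOfFinOrder g) : g = 1 := by
  by_contra h
  exact not_isOfFinOrder_of_isMulTorsionFree h hg

end Torsion

namespace BraidGroup

variable {n : ℕ}

/-- The map killing the generators of index at least `n`. -/
def trunc (n : ℕ) : FreeGroup ℕ →* FreeGroup (Fin n) :=
  FreeGroup.lift fun j => if h : j < n then .of ⟨j, h⟩ else 1

/-- The inclusion of the free group on the first `n` generators. -/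
def untrunc (n : ℕ) : FreeGroup (Fin n) →* FreeGroup ℕ := FreeGroup.map Fin.val

lemma trunc_of_lt {j : ℕ} (h : j < n) : trunc n (.of j) = .of ⟨j, h⟩ := by
  rw [trunc, FreeGroup.lift_apply_of, dif_pos h]

lemma trunc_of_ge {j : ℕ} (h : n ≤ j) : trunc n (.of j) = 1 := by
  rw [trunc, FreeGroup.lift_apply_of, dif_neg (by omega)]

lemma untrunc_of (j : Fin n) : untrunc n (.of j) = .of (j : ℕ) := FreeGroup.map.of

lemma trunc_untrunc (w : FreeGroup (Fin n)) : trunc n (untrunc n w) = w := by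
  have : (trunc n).comp (untrunc n) = MonoidHom.id _ :=
    FreeGroup.ext_hom _ _ fun j => by simp [untrunc_of, trunc_of_lt j.2]
  exact DFunLike.congr_fun this w

lemma trunc_act_untrunc_trunc (g : BraidGroup n) (w : FreeGroup ℕ) :
    trunc n (act n g (untrunc n (trunc n w))) = trunc n (act n g w) := by
  have : ((trunc n).comp (act n g).toMonoidHom).comp ((untrunc n).comp (trunc n)) =
      (trunc n).comp (act n g).toMonoidHom :=
    FreeGroup.ext_hom _ _ fun j => by
      rcases lt_or_ge j n with h | h
      · simp [untrunc_of, trunc_of_lt h]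
      · simp [trunc_of_ge h, act_of_ge g h]
  exact DFunLike.congr_fun this w

/-- The Artin action on the free group on `n` generators. -/
def actFin (n : ℕ) : BraidGroup n →* MulAut (FreeGroup (Fin n)) where
  toFun g := MonoidHom.toMulEquiv
    (((trunc n).comp (act n g).toMonoidHom).comp (untrunc n))
    (((trunc n).comp (act n g⁻¹).toMonoidHom).comp (untrunc n))
    (MonoidHom.ext fun w => by
      change trunc n (act n g⁻¹ (untrunc n (trunc n (act n g (untrunc n w))))) = w
      rw [trunc_act_untrunc_trunc, ← MulAut.mul_apply, ← map_mul, inv_mul_cancel, map_one,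
        MulAut.one_apply, trunc_untrunc])
    (MonoidHom.ext fun w => by
      change trunc n (act n g (untrunc n (trunc n (act n g⁻¹ (untrunc n w))))) = w
      rw [trunc_act_untrunc_trunc, ← MulAut.mul_apply, ← map_mul, mul_inv_cancel, map_one,
        MulAut.one_apply, trunc_untrunc])
  map_one' := MulEquiv.ext fun w => by simp [trunc_untrunc]
  map_mul' a b := MulEquiv.ext fun w => by simp [trunc_act_untrunc_trunc]

lemma actFin_trunc (g : BraidGroup n) (w : FreeGroup ℕ) :
    actFin n g (trunc n w) = trunc n (act n g w) := trunc_act_untrunc_trunc g w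

/-- The permutation of `Fin n` induced by a braid. -/
def permFin (n : ℕ) : BraidGroup n →* Equiv.Perm (Fin n) :=
  MonoidHom.toHomPerm
    { toFun := fun g j => ⟨perm n g j, perm_lt g j.2⟩
      map_one' := funext fun j => by simp only [map_one]; rfl
      map_mul' := fun a b => funext fun j => by simp only [map_mul]; rfl }

lemma isConj_actFin (g : BraidGroup n) (j : Fin n) :
    IsConj (actFin n g (.of j)) (.of (permFin n g j)) := by
  have h := (trunc n).map_isConj (isConj_act g j)
  rwa [← actFin_trunc, trunc_of_lt j.2, trunc_of_lt (perm_lt g j.2)] at h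

lemma degree_trunc_genProd (n : ℕ) : ∀ m ≤ n, degree (trunc n (genProd m)) = .ofAdd (m : ℤ) := by
  intro m
  induction m with
  | zero => intro _; simp [genProd]
  | succ m ih =>
    intro h
    rw [genProd, map_mul, map_mul, ih (by omega), trunc_of_lt (by omega), degree,
      FreeGroup.lift_apply_of, ← ofAdd_add]
    simp

lemma eq_one_of_le_one (hn : n ≤ 1) (g : BraidGroup n) : g = 1 := by
  induction g using gen_induction with
  | gen i hi => omega
  | one => rfl
  | mul a b ha hb => rw [ha, hb, mul_one]
  | inv a ha => rw [ha, inv_one]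

lemma exists_perm_fixed {p : ℕ} (hp : p.Prime) (hn : 0 < n) {g : BraidGroup n} (hg : g ^ p = 1) :
    ∃ j < n, perm n g j = j := by
  by_contra! h
  have : Fact p.Prime := ⟨hp⟩
  have h1 := degree_eq_one_of_fixedPointFree (p := p) (φ := actFin n g) (π := permFin n g)
    (by rw [← map_pow, hg, map_one]) (by rw [← map_pow, hg, map_one])
    (fun j hj => h j j.2 (congrArg Fin.val hj)) (isConj_actFin g)
    (d := trunc n (genProd n)) (by rw [actFin_trunc, act_genProd])
  rw [degree_trunc_genProd n n le_rfl] at h1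
  have : (n : ℤ) = 0 := h1
  omega

/-- Braid groups are torsion-free. -/
theorem torsionFree (n : ℕ) (g : BraidGroup n) (hg : IsOfFinOrder g) : g = 1 := by
  induction n with
  | zero => exact eq_one_of_le_one (by omega) g
  | succ m ih =>
    refine eq_one_of_isOfFinOrder (fun p hp β hβ => ?_) hg
    obtain ⟨j, hj, hjp⟩ := exists_perm_fixed hp (Nat.succ_pos m) hβ
    set s := shift (m + 1) j
    have hs : perm (m + 1) s 0 = j := perm_shift hj
    have h0 : perm (m + 1) (s⁻¹ * β * s) 0 = 0 := by
      rw [map_mul, map_mul, Equiv.Perm.mul_apply, Equiv.Perm.mul_apply, hs, hjp, map_inv,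
        Equiv.Perm.inv_eq_iff_eq, hs]
    have h1 : (s⁻¹ * β * s) ^ p = 1 := by
      have := conj_pow (i := p) (a := s⁻¹) (b := β)
      rw [inv_inv] at this
      rw [this, hβ]; group
    have h2 : cocycle m (s⁻¹ * β * s) ^ p = 1 := by
      rw [← monoCocycle_pow _ h0, h1, monoCocycle_one]
    have h3 := semidirectProduct_torsionFree freeGroup_torsionFree ih _
      (isOfFinOrder_iff_pow_eq_one.2 ⟨p, hp.pos, h2⟩)
    have h4 := eq_incl_cocycle h0
    rw [h3, map_one] at h4
    simpa [mul_assoc, inv_mul_eq_one] using h4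

end BraidGroup

lemma FreeBraid.torsionFree (n : ℕ) (g : FreeBraid n) (hg : IsOfFinOrder g) : g = 1 :=
  semidirectProduct_torsionFree freeGroup_torsionFree (BraidGroup.torsionFree n) g hg

lemma FreeBraid.closure_gen_pt_zero (n : ℕ) :
    Subgroup.closure {g | (∃ i, i + 1 < n ∧ g = br n i) ∨ g = pt n 0 ∨
      ∃ i, n ≤ i ∧ g = pt n i} = ⊤ := by
  rw [eq_top_iff, ← closure_gen n, Subgroup.closure_le]
  have hbr : ∀ i, i + 1 < n → br n i ∈ Subgroup.closure {g | (∃ i, i + 1 < n ∧ g = br n i) ∨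
      g = pt n 0 ∨ ∃ i, n ≤ i ∧ g = pt n i} :=
    fun i hi => Subgroup.subset_closure (Or.inl ⟨i, hi, rfl⟩)
  rintro _ (⟨i, hi, rfl⟩ | ⟨i, rfl⟩)
  · exact hbr i hi
  · rcases lt_or_ge i n with h | h
    · induction i with
      | zero => exact Subgroup.subset_closure (Or.inr (Or.inl rfl))
      | succ i ih =>
        rw [← (isBraidSystem n).conj_self i h]
        exact mul_mem (mul_mem (hbr i h) (ih (by omega))) (inv_mem (hbr i h))
    · exact Subgroup.subset_closure (Or.inr (Or.inr ⟨i, h, rfl⟩))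

namespace BraidGroup

lemma incl_pt_of_ge {m i : ℕ} (h : m ≤ i) : incl m (FreeBraid.pt m i) = 1 := by
  rcases Nat.eq_zero_or_pos i with rfl | h0
  · rw [incl_pt_zero, (isBraid_gen (m + 1)).triv 0 (by omega), one_pow]
  · exact (FreeBraid.lift_pt _ _).trans (conjSeq_of_ge _ h h0.ne')

lemma act_incl_br {m i : ℕ} (h : i + 1 < m) :
    act (m + 1) (incl m (FreeBraid.br m i)) = artinAut (i + 1) := by
  rw [incl_br, act_gen (by omega)]

lemma act_incl_pt_zero {m : ℕ} (h : 0 < m) :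
    act (m + 1) (incl m (FreeBraid.pt m 0)) = artinAut 0 * artinAut 0 := by
  rw [incl_pt_zero, map_pow, act_gen (by omega), pow_two]

lemma artinAut_zero_sq_of_zero : (artinAut 0 * artinAut 0) (.of 0) =
    (.of 0 * .of 1)⁻¹ * .of 0 * (.of 0 * .of 1) := by
  rw [MulAut.mul_apply, artinAut_self, artinAut_succ]
  group

lemma artinAut_zero_sq_of_one : (artinAut 0 * artinAut 0) (.of 1) =
    (.of 0 * .of 1)⁻¹ * .of 1 * (.of 0 * .of 1) := by
  rw [MulAut.mul_apply, ← zero_add 1, artinAut_succ]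
  simp only [map_mul, map_inv, artinAut_self, artinAut_succ]
  group

lemma artinAut_zero_sq_of_other {j : ℕ} (h0 : j ≠ 0) (h1 : j ≠ 1) :
    (artinAut 0 * artinAut 0) (.of j) = .of j := by
  rw [MulAut.mul_apply, artinAut_other h0 h1, artinAut_other h0 h1]

/-- The map killing the first free generator and lowering the indices of the others. -/
def forget : FreeGroup ℕ →* FreeGroup ℕ :=
  FreeGroup.lift fun j => match j with
    | 0 => 1
    | j + 1 => .of j

lemma forget_of_zero : forget (.of 0) = 1 := FreeGroup.lift_apply_of

lemma forget_of_succ (j : ℕ) : forget (.of (j + 1)) = .of j := FreeGroup.lift_apply_of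

lemma forget_surjective : Function.Surjective forget := fun w => by
  refine ⟨FreeGroup.map Nat.succ w, ?_⟩
  have : forget.comp (FreeGroup.map Nat.succ) = MonoidHom.id _ :=
    FreeGroup.ext_hom _ _ fun j => by simp [forget_of_succ]
  exact DFunLike.congr_fun this w

lemma forget_act_incl {m : ℕ} (h : FreeBraid m) (w : FreeGroup ℕ) :
    forget (act (m + 1) (incl m h) w) = act m h.right (forget w) := by
  have key := equivariant_free_of_closure ((act (m + 1)).comp (incl m))
    ((SemidirectProduct.inl : _ →* FreeBraid m).comp forget)
    (SemidirectProduct.inr.comp SemidirectProduct.rightHom) (FreeBraid.closure_gen_pt_zero m)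
    (fun q hq j => by
      rw [MonoidHom.comp_apply, MonoidHom.comp_apply, MonoidHom.comp_apply, MonoidHom.comp_apply,
        ← map_inv, ← SemidirectProduct.inl_aut, SemidirectProduct.inl_inj]
      obtain ⟨i, hi, rfl⟩ | rfl | ⟨i, hi, rfl⟩ := hq
      · rw [act_incl_br hi, FreeBraid.br, SemidirectProduct.rightHom_inr, act_gen hi]
        obtain rfl | ⟨j, rfl⟩ : j = 0 ∨ ∃ k, j = k + 1 := by cases j <;> simp
        · rw [artinAut_other (by omega) (by omega), forget_of_zero, map_one]
        rw [forget_of_succ]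
        by_cases h1 : j = i
        · subst h1
          rw [artinAut_self, artinAut_self, forget_of_succ]
        by_cases h2 : j = i + 1
        · subst h2
          rw [artinAut_succ, artinAut_succ]
          simp only [map_mul, map_inv, forget_of_succ]
        · rw [artinAut_other h1 h2, artinAut_other (by omega) (by omega), forget_of_succ]
      · rw [FreeBraid.pt, SemidirectProduct.rightHom_inl, map_one, MulAut.one_apply]
        rcases Nat.eq_zero_or_pos m with rfl | hm
        · rw [← FreeBraid.pt, incl_pt_of_ge le_rfl, map_one, MulAut.one_apply]
        rw [← FreeBraid.pt, act_incl_pt_zero hm]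
        by_cases h0 : j = 0
        · subst h0
          rw [artinAut_zero_sq_of_zero]
          simp only [map_mul, map_inv, forget_of_zero]
          group
        by_cases h1 : j = 1
        · subst h1
          rw [artinAut_zero_sq_of_one]
          simp only [map_mul, map_inv, forget_of_zero]
          group
        · rw [artinAut_zero_sq_of_other h0 h1]
      · rw [incl_pt_of_ge hi, FreeBraid.pt, SemidirectProduct.rightHom_inl, map_one, map_one,
          MulAut.one_apply, MulAut.one_apply]) h w
  rw [MonoidHom.comp_apply, MonoidHom.comp_apply, MonoidHom.comp_apply, MonoidHom.comp_apply,
    ← map_inv, ← SemidirectProduct.inl_aut, SemidirectProduct.inl_inj] at key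
  exact key

lemma perm_eq_of_act_eq_one {n : ℕ} {z : BraidGroup n} (hz : act n z = 1) (j : ℕ) :
    perm n z j = j := by
  have h := isConj_act z j
  rw [hz, MulAut.one_apply] at h
  have h1 := isConj_iff_eq.1 ((expSum j).map_isConj h)
  rw [expSum_of, expSum_of, if_pos rfl] at h1
  by_contra hne
  rw [if_neg hne] at h1
  exact one_ne_zero (ofAdd_eq_one.1 h1)

lemma eq_zero_of_artinAut_zero_sq_zpow {k : ℤ} (h : (artinAut 0 * artinAut 0) ^ k = 1) :
    k = 0 := by
  set A := artinAut 0 * artinAut 0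
  set D : FreeGroup ℕ := .of 0 * .of 1 with hD
  have hAD : A D = D := by
    rw [hD, map_mul, artinAut_zero_sq_of_zero, artinAut_zero_sq_of_one]
    group
  have hc : Commute (MulAut.conj D) A := MulEquiv.ext fun w => by
    simp [hAD]
  have hs : MulAut.conj D * A ∈ MulAction.stabilizer (MulAut (FreeGroup ℕ)) (FreeGroup.of 0) := by
    rw [MulAction.mem_stabilizer_iff, MulAut.smul_def, MulAut.mul_apply, MulAut.conj_apply,
      artinAut_zero_sq_of_zero, ← hD]
    group
  have hk := zpow_mem hs k
  rw [hc.mul_zpow, h, mul_one, ← map_zpow, MulAction.mem_stabilizer_iff, MulAut.smul_def,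
    MulAut.conj_apply, mul_inv_eq_iff_eq_mul] at hk
  obtain ⟨l, hl⟩ := exists_eq_zpow_of_commute_of (f := D ^ k) (a := 0) hk
  have := congrArg Multiplicative.toAdd (congrArg (expSum 1) hl)
  simpa [hD, expSum_of] using this

/-- A central braid acting trivially on the free group is trivial. -/
theorem eq_one_of_commute_of_act_eq_one {n : ℕ} {z : BraidGroup n} (hz : ∀ g, Commute z g)
    (ha : act n z = 1) : z = 1 := by
  induction n with
  | zero => exact eq_one_of_le_one (by omega) z
  | succ m ih =>
    rcases Nat.eq_zero_or_pos m with rfl | hm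
    · exact eq_one_of_le_one le_rfl z
    have hp : perm (m + 1) z 0 = 0 := perm_eq_of_act_eq_one ha 0
    have hzi := eq_incl_cocycle hp
    have hcom : ∀ g, perm (m + 1) g 0 = 0 → Commute (cocycle m z) (cocycle m g) := fun g hg => by
      rw [Commute, SemiconjBy, ← monoCocycle_mul _ _ hp hg, ← monoCocycle_mul _ _ hg hp, (hz g).eq]
    set h := cocycle m z
    have hbr : ∀ i, i + 1 < m → Commute h (FreeBraid.br m i) := fun i hi => by
      rw [← monoCocycle_gen_succ (FreeBraid.isBraidSystem m) hi]
      refine hcom _ ?_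
      rw [perm_gen (by omega), Equiv.swap_apply_of_ne_of_ne (by omega) (by omega)]
    have hpt : ∀ i, i < m → Commute h (FreeBraid.pt m i) := fun i hi => by
      induction i with
      | zero =>
        rw [← monoCocycle_gen_zero_sq (FreeBraid.isBraidSystem m) hm]
        refine hcom _ ?_
        rw [pow_two, map_mul, perm_gen (by omega), Equiv.swap_mul_self, Equiv.Perm.one_apply]
      | succ i ih =>
        rw [← (FreeBraid.isBraidSystem m).conj_self i hi]
        exact ((hbr i hi).mul_right (ih (by omega))).mul_right (hbr i hi).inv_right
    have hb : h.right = 1 := by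
      refine ih (fun g => ?_) (MulEquiv.ext fun w => ?_)
      · induction g using gen_induction with
        | gen i hi => exact (hbr i hi).map SemidirectProduct.rightHom
        | one => exact Commute.one_right _
        | mul a b ha hb => exact ha.mul_right hb
        | inv a ha => exact ha.inv_right
      · obtain ⟨w, rfl⟩ := forget_surjective w
        rw [← forget_act_incl, ← hzi, ha, MulAut.one_apply, MulAut.one_apply]
    have hf : h = SemidirectProduct.inl h.left := by
      conv_lhs => rw [← SemidirectProduct.inl_left_mul_inr_right h, hb, map_one, mul_one]
    have hfc : ∀ i, i < m → Commute h.left (.of i) := fun i hi => by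
      have := hpt i hi
      rw [hf] at this
      apply SemidirectProduct.inl_injective (φ := act m)
      rw [map_mul, map_mul]
      exact this
    rcases Nat.lt_or_ge 1 m with h2 | h2
    · rw [hzi, hf, eq_one_of_commute_of_of zero_ne_one (hfc 0 hm) (hfc 1 h2), map_one, map_one]
    · obtain ⟨k, hk⟩ := exists_eq_zpow_of_commute_of (hfc 0 hm)
      have hz' : z = incl m (FreeBraid.pt m 0) ^ k := by
        rw [hzi, hf, hk, map_zpow, map_zpow]; rfl
      rw [hz', map_zpow, act_incl_pt_zero hm] at ha
      rw [hz', eq_zero_of_artinAut_zero_sq_zpow ha, zpow_zero]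

end BraidGroup

section JucysMurphy

variable {Γ : Type*} [Group Γ] {n : ℕ} {σ x : ℕ → Γ} {a : Γ}

/-- The Jucys-Murphy elements attached to `a`. -/
def jm (σ : ℕ → Γ) (a : Γ) : ℕ → Γ
  | 0 => a
  | i + 1 => σ i * jm σ a i * σ i

/-- The product of the first `m` Jucys-Murphy elements. -/
def jmProd (σ : ℕ → Γ) (a : Γ) : ℕ → Γ
  | 0 => 1
  | m + 1 => jm σ a m * jmProd σ a m

/-- The product of the first `m` terms of a sequence. -/
def prodSeq (x : ℕ → Γ) : ℕ → Γ
  | 0 => 1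
  | m + 1 => prodSeq x m * x m

/-- The product of the first `k` terms of a sequence, in reverse order. -/
def sweep (σ : ℕ → Γ) : ℕ → Γ
  | 0 => 1
  | k + 1 => σ k * sweep σ k

lemma commute_jm {g : Γ} (hg : Commute g a) {k : ℕ} (h : ∀ i < k, Commute g (σ i)) :
    Commute g (jm σ a k) := by
  induction k with
  | zero => exact hg
  | succ k ih =>
    exact ((h k (by omega)).mul_right (ih fun i hi => h i (by omega))).mul_right (h k (by omega))

lemma commute_jmProd {g : Γ} {m : ℕ} (h : ∀ k < m, Commute g (jm σ a k)) :
    Commute g (jmProd σ a m) := by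
  induction m with
  | zero => exact Commute.one_right _
  | succ m ih => exact (h m (by omega)).mul_right (ih fun i hi => h i (by omega))

lemma jm_four (h : IsBraid n σ) (ha : ∀ i, 1 ≤ i → i + 1 < n → Commute (σ i) a)
    (h4 : 1 < n → σ 0 * a * σ 0 * a = a * σ 0 * a * σ 0) {i : ℕ} (hi : i + 1 < n) :
    σ i * jm σ a i * σ i * jm σ a i = jm σ a i * σ i * jm σ a i * σ i := by
  induction i with
  | zero => exact h4 hi
  | succ i ih =>
    have ih := ih (by omega)
    have hb := h.braid i hi
    have hc : Commute (σ (i + 1)) (jm σ a i) :=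
      commute_jm (ha _ (by omega) hi) fun k hk => (h.comm k (i + 1) (by omega)).symm
    rw [jm]
    set s := σ i
    set t := σ (i + 1)
    set J := jm σ a i
    calc t * (s * J * s) * t * (s * J * s) = t * s * J * (s * t * s) * J * s := by group
      _ = t * s * (J * t) * s * (t * J) * s := by rw [hb]; group
      _ = (t * s * t) * J * s * (t * J) * s := by rw [← hc.eq]; group
      _ = s * t * (s * J * s * J) * t * s := by rw [hc.eq, ← hb]; group
      _ = s * t * J * s * J * (s * t * s) := by rw [ih]; group
      _ = s * (t * J) * s * (J * t) * s * t := by rw [hb]; group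
      _ = s * (J * t) * s * (t * J) * s * t := by rw [hc.eq]
      _ = s * J * (t * s * t) * J * s * t := by group
      _ = s * J * s * t * (s * J * s) * t := by rw [← hb]; group

lemma commute_jm_of_add_two_le (h : IsBraid n σ) (ha : ∀ i, 1 ≤ i → i + 1 < n → Commute (σ i) a)
    {i j : ℕ} (hij : i + 2 ≤ j) (hj : j < n) : Commute (σ i) (jm σ a j) := by
  induction j, hij using Nat.le_induction with
  | base =>
    have hb := h.braid i hj
    have hc : Commute (σ (i + 1)) (jm σ a i) :=
      commute_jm (ha _ (by omega) hj) fun k hk => (h.comm k (i + 1) (by omega)).symm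
    rw [jm, jm, Commute, SemiconjBy]
    set s := σ i
    set t := σ (i + 1)
    set J := jm σ a i
    calc s * (t * (s * J * s) * t) = (s * t * s) * J * s * t := by group
      _ = t * s * (t * J) * s * t := by rw [hb]; group
      _ = t * s * J * (t * s * t) := by rw [hc.eq]; group
      _ = t * (s * J * s) * t * s := by rw [← hb]; group
  | succ j hij ih =>
    exact ((h.comm i j hij).mul_right (ih (by omega))).mul_right (h.comm i j hij)

lemma commute_jmProd_braid (h : IsBraid n σ) (ha : ∀ i, 1 ≤ i → i + 1 < n → Commute (σ i) a)
    (h4 : 1 < n → σ 0 * a * σ 0 * a = a * σ 0 * a * σ 0) {i m : ℕ} (hi : i + 2 ≤ m) (hm : m ≤ n) :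
    Commute (σ i) (jmProd σ a m) := by
  induction m, hi using Nat.le_induction with
  | base =>
    rw [jmProd, jmProd, ← mul_assoc]
    refine Commute.mul_right ?_ (commute_jmProd fun k hk =>
      commute_jm (ha i (by omega) (by omega)) fun l hl => (h.comm l i (by omega)).symm)
    have h4 := jm_four h ha h4 (show i + 1 < n by omega)
    rw [jm, Commute, SemiconjBy, h4, ← mul_assoc, ← mul_assoc, ← mul_assoc, ← h4]
  | succ m hi ih =>
    exact (commute_jm_of_add_two_le h ha hi (by omega)).mul_right (ih (by omega))

lemma commute_jm_left (ha : ∀ i, 1 ≤ i → i + 1 < n → Commute (σ i) a)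
    (h4 : 1 < n → σ 0 * a * σ 0 * a = a * σ 0 * a * σ 0) {j : ℕ} (hj : j < n) :
    Commute a (jm σ a j) := by
  rcases Nat.eq_zero_or_pos j with rfl | h0
  · exact Commute.refl _
  induction j, h0 using Nat.le_induction with
  | base =>
    have := h4 hj
    rw [jm, jm, Commute, SemiconjBy, this]
    simp only [mul_assoc]
  | succ j h0 ih =>
    have hc := (ha j h0 hj).symm
    exact (hc.mul_right (ih (by omega))).mul_right hc

lemma jm_eq_conjSeq_mul (a : Γ) {k : ℕ} (hk : k < n) : jm σ a k = conjSeq n σ a k * jm σ 1 k := by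
  induction k with
  | zero => exact (mul_one a).symm
  | succ k ih => rw [jm, jm, ih (by omega), conjSeq_succ a hk]; group

namespace IsBraidSystem

lemma sweep_conj (h : IsBraidSystem n σ x) {k : ℕ} (hk : k < n) :
    sweep σ k * x 0 * (sweep σ k)⁻¹ = x k := by
  induction k with
  | zero => simp [sweep]
  | succ k ih => rw [← h.conj_self k hk, ← ih (by omega), sweep]; group

lemma commute_prodSeq (h : IsBraidSystem n σ x) {i m : ℕ} (hi : i + 1 < n)
    (him : m ≤ i ∨ i + 2 ≤ m) : Commute (σ i) (prodSeq x m) := by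
  have h1 : ∀ m ≤ i, Commute (σ i) (prodSeq x m) := fun m hm => by
    induction m with
    | zero => exact Commute.one_right _
    | succ m ih => exact (ih (by omega)).mul_right (h.conj_other i m hi (by omega) (by omega))
  rcases him with him | him
  · exact h1 m him
  induction m, him using Nat.le_induction with
  | base =>
    rw [prodSeq, prodSeq, mul_assoc]
    exact (h1 i le_rfl).mul_right (h.conj_prod i hi)
  | succ m him ih => exact ih.mul_right (h.conj_other i m hi (by omega) (by omega))

lemma loop_conj (h : IsBraidSystem n σ x) {k : ℕ} (hk : k < n) :
    jm σ 1 k * x k * (jm σ 1 k)⁻¹ = (prodSeq x (k + 1))⁻¹ * x k * prodSeq x (k + 1) := by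
  induction k with
  | zero => simp [jm, prodSeq]
  | succ k ih =>
    have hc : Commute (x (k + 1)) (jm σ 1 k) := commute_jm (Commute.one_right _)
      fun i hi => (h.conj_other i (k + 1) (by omega) (by omega) (by omega)).symm
    have hP := h.commute_prodSeq hk (m := k + 2) (Or.inr le_rfl)
    have hs := h.conj_succ hk
    have ih := ih (by omega)
    have hx := h.conj_self k hk
    have hP' : prodSeq x (k + 2) = prodSeq x (k + 1) * x (k + 1) := rfl
    rw [jm]
    set A := jm σ 1 k
    set s := σ k
    set P := prodSeq x (k + 1)
    calc s * A * s * x (k + 1) * (s * A * s)⁻¹ = s * (A * (s * x (k + 1) * s⁻¹) * A⁻¹) * s⁻¹ := by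
          group
      _ = s * ((A * x (k + 1) * A⁻¹)⁻¹ * (A * x k * A⁻¹) * (A * x (k + 1) * A⁻¹)) * s⁻¹ := by
          rw [hs]; group
      _ = s * ((P * x (k + 1))⁻¹ * x k * (P * x (k + 1))) * s⁻¹ := by
          rw [ih, ← hc.eq]; group
      _ = (s * prodSeq x (k + 2) * s⁻¹)⁻¹ * (s * x k * s⁻¹) * (s * prodSeq x (k + 2) * s⁻¹) := by
          rw [hP']; group
      _ = _ := by rw [hx, hP.eq, mul_inv_cancel_right]

end IsBraidSystem

end JucysMurphy

section Affine

variable {Γ : Type*} [Group Γ] {N : ℕ} {σ w : ℕ → Γ} {a b : Γ}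

/-- The sequence `σ` together with the end terms `a` and `b` satisfies the relations of the
euclidean Artin group of type `C̃` of rank `N + 1`. -/
structure IsCtilde (N : ℕ) (σ : ℕ → Γ) (a b : Γ) : Prop extends IsBraid (N + 1) σ where
  left_comm : ∀ i, 1 ≤ i → i + 1 < N + 1 → Commute (σ i) a
  left_four : 1 < N + 1 → σ 0 * a * σ 0 * a = a * σ 0 * a * σ 0
  right_comm : ∀ i, i + 1 < N → Commute (σ i) b
  right_four : σ (N - 1) * b * σ (N - 1) * b = b * σ (N - 1) * b * σ (N - 1)
  comm_ends : Commute a b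

/-- The reversal of the sequence of inverses. -/
def mirror (N : ℕ) (σ : ℕ → Γ) (i : ℕ) : Γ := if i < N then (σ (N - 1 - i))⁻¹ else 1

lemma mirror_of_lt {i : ℕ} (h : i < N) : mirror N σ i = (σ (N - 1 - i))⁻¹ := if_pos h

lemma mirror_sub {i : ℕ} (h : i < N) : mirror N σ (N - 1 - i) = (σ i)⁻¹ := by
  rw [mirror_of_lt (by omega), show N - 1 - (N - 1 - i) = i by omega]

lemma IsBraid.mirror (h : IsBraid (N + 1) σ) : IsBraid (N + 1) (mirror N σ) where
  comm i j hij := by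
    by_cases hj : j < N
    · rw [mirror_of_lt hj, mirror_of_lt (by omega)]
      exact (h.commute' (i := N - 1 - i) (j := N - 1 - j) (Or.inr (by omega))).inv_inv
    · rw [ArtinCtilde.mirror, ArtinCtilde.mirror, if_neg hj]
      exact Commute.one_right _
  braid i hi := by
    rw [mirror_of_lt (by omega), mirror_of_lt (by omega)]
    have := h.braid (N - 1 - (i + 1)) (by omega)
    rw [show N - 1 - (i + 1) + 1 = N - 1 - i by omega] at this
    simpa only [mul_inv_rev, mul_assoc] using congrArg (·⁻¹) this.symm
  triv i hi := if_neg (by omega)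

/-- The reversal of a braid system. -/
lemma IsBraidSystem.reverse (h : IsBraidSystem (N + 1) (mirror N σ) w) (hσ : IsBraid (N + 1) σ) :
    IsBraidSystem (N + 1) σ fun k => if k ≤ N then (w (N - k))⁻¹ else 1 where
  toIsBraid := hσ
  conj_self i hi := by
    have := h.conj_self (N - 1 - i) (by omega)
    rw [mirror_sub (by omega), show N - 1 - i + 1 = N - i by omega] at this
    simp only [show i ≤ N by omega, show i + 1 ≤ N by omega, if_true]
    rw [← this, show N - (i + 1) = N - 1 - i by omega]
    group
  conj_prod i hi := by
    have := h.conj_prod (N - 1 - i) (by omega)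
    rw [mirror_sub (by omega), show N - 1 - i + 1 = N - i by omega] at this
    simp only [show i ≤ N by omega, show i + 1 ≤ N by omega, if_true]
    rw [← mul_inv_rev, show N - (i + 1) = N - 1 - i by omega]
    simpa using this.inv_inv
  conj_other i j hi h1 h2 := by
    by_cases hj : j ≤ N
    · have := h.conj_other (N - 1 - i) (N - j) (by omega) (by omega) (by omega)
      rw [mirror_sub (by omega)] at this
      simp only [hj, if_true]
      simpa using this.inv_inv
    · simp [hj]

namespace IsCtilde

variable (h : IsCtilde N σ a b)
include h

lemma isBraidSystem_left : IsBraidSystem (N + 1) σ (conjSeq (N + 1) σ a) :=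
  isBraidSystem_conjSeq h.toIsBraid h.left_comm h.left_four

end IsCtilde

/-- The conjugates of `b` obtained by reversing the construction of `conjSeq`. -/
def rightSeq (N : ℕ) (σ : ℕ → Γ) (b : Γ) (k : ℕ) : Γ :=
  if k ≤ N then (conjSeq (N + 1) (mirror N σ) b⁻¹ (N - k))⁻¹ else 1

lemma rightSeq_self (N : ℕ) (σ : ℕ → Γ) (b : Γ) : rightSeq N σ b N = b := by
  rw [rightSeq, if_pos le_rfl, Nat.sub_self, conjSeq, inv_inv]

lemma rightSeq_of_gt (σ : ℕ → Γ) (b : Γ) {k : ℕ} (hk : N < k) : rightSeq N σ b k = 1 :=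
  if_neg (by omega)

/-- The first term of the extension of `rightSeq`. -/
def rightZero (N : ℕ) (σ : ℕ → Γ) (a b : Γ) : Γ :=
  (jmProd σ a (N + 1))⁻¹ * (prodSeq (rightSeq N σ b) (N + 1))⁻¹

namespace IsCtilde

lemma isBraidSystem_right (h : IsCtilde N σ a b) : IsBraidSystem (N + 1) σ (rightSeq N σ b) := by
  refine (isBraidSystem_conjSeq h.toIsBraid.mirror (fun i h1 hi => ?_) fun hN => ?_).reverse
    h.toIsBraid
  · rw [mirror_of_lt (by omega)]
    exact (h.right_comm _ (by omega)).inv_inv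
  · rw [mirror_of_lt (by omega), Nat.sub_zero]
    simpa only [mul_inv_rev, mul_assoc] using congrArg (·⁻¹) h.right_four.symm

lemma commute_left_rightSeq (h : IsCtilde N σ a b) {k : ℕ} (hk : 1 ≤ k) :
    Commute a (rightSeq N σ b k) := by
  have key : ∀ m, m + 1 ≤ N → Commute a (conjSeq (N + 1) (mirror N σ) b⁻¹ m) := fun m hm => by
    induction m with
    | zero => exact h.comm_ends.inv_right
    | succ m ih =>
      rw [conjSeq_succ _ (by omega), mirror_of_lt (by omega)]
      have hc := (h.left_comm (N - 1 - m) (by omega) (by omega)).symm.inv_right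
      exact (hc.mul_right (ih (by omega))).mul_right hc.inv_right
  by_cases hkN : k ≤ N
  · rw [rightSeq, if_pos hkN]
    exact (key _ (by omega)).inv_right
  · rw [rightSeq_of_gt _ _ (by omega)]
    exact Commute.one_right _

lemma commute_left_tail (h : IsCtilde N σ a b) (m : ℕ) :
    Commute a ((rightSeq N σ b 0)⁻¹ * prodSeq (rightSeq N σ b) (m + 1)) := by
  induction m with
  | zero => simp [prodSeq]
  | succ m ih =>
    rw [prodSeq, ← mul_assoc]
    exact ih.mul_right (h.commute_left_rightSeq (by omega))

lemma commute_left_jmProd (h : IsCtilde N σ a b) : Commute a (jmProd σ a (N + 1)) :=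
  commute_jmProd fun _ hk => commute_jm_left h.left_comm h.left_four hk

lemma commute_braid_rightZero (h : IsCtilde N σ a b) {i : ℕ} (hi : i + 1 < N + 1) :
    Commute (σ i) (rightZero N σ a b) :=
  (commute_jmProd_braid h.toIsBraid h.left_comm h.left_four hi le_rfl).inv_right.mul_right
    (h.isBraidSystem_right.commute_prodSeq hi (Or.inr hi)).inv_right

lemma commute_left_rightZero_mul (h : IsCtilde N σ a b) :
    Commute a (rightZero N σ a b * rightSeq N σ b 0) := by
  have := h.commute_left_jmProd.inv_right.mul_right (h.commute_left_tail N).inv_right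
  rwa [mul_inv_rev, inv_inv, ← mul_assoc] at this

lemma commute_rightZero_mul_left (h : IsCtilde N σ a b) :
    Commute (rightZero N σ a b * rightSeq N σ b 0 * a) (rightSeq N σ b 0) := by
  have hz := h.isBraidSystem_right
  have hx := h.isBraidSystem_left
  set z := rightSeq N σ b with hzdef
  set s := sweep σ N with hs
  set c := jmProd σ a (N + 1) with hc
  set Y := prodSeq z (N + 1) with hY
  have hsc : ∀ k ≤ N, ∀ g, (∀ i < N, Commute (σ i) g) → Commute (sweep σ k) g := fun k hk g hg => by
    induction k with
    | zero => exact Commute.one_left _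
    | succ k ih => exact (hg k (by omega)).mul_left (ih (by omega))
  have h1 : Commute s c := hsc N le_rfl _ fun i hi =>
    commute_jmProd_braid h.toIsBraid h.left_comm h.left_four (by omega) le_rfl
  have h2 : Commute s Y := hsc N le_rfl _ fun i hi =>
    hz.commute_prodSeq (by omega) (Or.inr (by omega))
  have h3 : s * a * s⁻¹ = conjSeq (N + 1) σ a N := hx.sweep_conj (by omega)
  have h4 : s * z 0 * s⁻¹ = b := (hz.sweep_conj (by omega)).trans (rightSeq_self _ _ _)
  have h5 : c = conjSeq (N + 1) σ a N * jm σ 1 N * jmProd σ a N := by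
    rw [← jm_eq_conjSeq_mul a (by omega)]; rfl
  have h6 : Commute (jmProd σ a N) b := (commute_jmProd fun k hk =>
    commute_jm h.comm_ends.symm fun i hi => (h.right_comm i (by omega)).symm).symm
  have h7 : jm σ 1 N * b * (jm σ 1 N)⁻¹ = Y⁻¹ * b * Y := by
    have := hz.loop_conj (k := N) (by omega)
    rwa [hzdef, rightSeq_self] at this
  have h8 : Commute (Y * jm σ 1 N) b := by
    rw [Commute, SemiconjBy, ← mul_inv_eq_iff_eq_mul, mul_inv_rev]
    calc _ = Y * (jm σ 1 N * b * (jm σ 1 N)⁻¹) * Y⁻¹ := by group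
      _ = b := by rw [h7]; group
  have h9 : rightZero N σ a b * z 0 * a = c⁻¹ * a * (Y⁻¹ * z 0) := by
    have := (h.commute_left_tail N).inv_right.eq
    rw [← hzdef, ← hY, mul_inv_rev, inv_inv] at this
    rw [mul_assoc c⁻¹, this, rightZero, ← hc, ← hzdef, ← hY]
    group
  have h10 : s * (c⁻¹ * a * (Y⁻¹ * z 0)) * s⁻¹ =
      (jmProd σ a N)⁻¹ * (Y * jm σ 1 N)⁻¹ * b := by
    calc _ = (s * c * s⁻¹)⁻¹ * (s * a * s⁻¹) * ((s * Y * s⁻¹)⁻¹ * (s * z 0 * s⁻¹)) := by group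
      _ = c⁻¹ * conjSeq (N + 1) σ a N * (Y⁻¹ * b) := by
        rw [h1.eq, h2.eq, h3, h4, mul_inv_cancel_right, mul_inv_cancel_right]
      _ = _ := by rw [h5]; group
  have h11 : Commute (s * (c⁻¹ * a * (Y⁻¹ * z 0)) * s⁻¹) (s * z 0 * s⁻¹) := by
    rw [h10, h4]
    exact (h6.inv_left.mul_left h8.inv_left).mul_left (Commute.refl b)
  rw [h9]
  simpa [mul_assoc] using commute_conj (g := s⁻¹) h11

lemma left_conj_right_zero (h : IsCtilde N σ a b) : a * rightSeq N σ b 0 * a⁻¹ =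
    (rightZero N σ a b * rightSeq N σ b 0)⁻¹ * rightSeq N σ b 0 *
      (rightZero N σ a b * rightSeq N σ b 0) := by
  have := h.commute_rightZero_mul_left.eq
  rw [mul_inv_eq_iff_eq_mul, mul_assoc, mul_assoc, eq_inv_mul_iff_mul_eq, ← mul_assoc, this]

lemma left_conj_rightZero (h : IsCtilde N σ a b) : a * rightZero N σ a b * a⁻¹ =
    (rightZero N σ a b * rightSeq N σ b 0)⁻¹ * rightZero N σ a b *
      (rightZero N σ a b * rightSeq N σ b 0) := by
  have h1 := h.left_conj_right_zero
  have h2 := h.commute_left_rightZero_mul.eq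
  calc a * rightZero N σ a b * a⁻¹ = a * (rightZero N σ a b * rightSeq N σ b 0) * a⁻¹ *
        (a * rightSeq N σ b 0 * a⁻¹)⁻¹ := by group
    _ = _ := by rw [h1, h2]; group

end IsCtilde

end Affine

open BraidGroup

/-- The semidirect product of a free group and `FreeBraid n`, where `FreeBraid n` acts as a
subgroup of the braid group on `n + 1` strands. -/
abbrev AffineModel (n : ℕ) : Type := FreeGroup ℕ ⋊[(act (n + 1)).comp (incl n)] FreeBraid n

namespace AffineModel

lemma torsionFree {n : ℕ} (g : AffineModel n) (hg : IsOfFinOrder g) : g = 1 :=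
  semidirectProduct_torsionFree freeGroup_torsionFree (FreeBraid.torsionFree n) g hg

section Retract

variable {Γ : Type*} [Group Γ] {N : ℕ} {σ : ℕ → Γ} {a b : Γ}

/-- The sequence `rightSeq` preceded by `rightZero`. -/
def extSeq (N : ℕ) (σ : ℕ → Γ) (a b : Γ) : ℕ → Γ
  | 0 => rightZero N σ a b
  | k + 1 => rightSeq N σ b k

lemma extSeq_br (h : IsCtilde N σ a b) {i : ℕ} (hi : i + 1 < N + 1) (j : ℕ) :
    FreeGroup.lift (extSeq N σ a b) (artinAut (i + 1) (.of j)) =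
      σ i * extSeq N σ a b j * (σ i)⁻¹ := by
  have hs := h.isBraidSystem_right
  obtain rfl | ⟨j, rfl⟩ : j = 0 ∨ ∃ k, j = k + 1 := by cases j <;> simp
  · rw [artinAut_other (by omega) (by omega), FreeGroup.lift_apply_of]
    exact eq_mul_inv_of_mul_eq (h.commute_braid_rightZero hi).eq.symm
  by_cases h1 : j = i
  · subst h1
    rw [artinAut_self, FreeGroup.lift_apply_of]
    exact (hs.conj_self j hi).symm
  by_cases h2 : j = i + 1
  · subst h2
    rw [artinAut_succ]
    simp only [map_mul, map_inv, FreeGroup.lift_apply_of]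
    exact (hs.conj_succ hi).symm
  · rw [artinAut_other (by omega) (by omega), FreeGroup.lift_apply_of]
    exact eq_mul_inv_of_mul_eq (hs.conj_other i j hi h1 h2).eq.symm

lemma extSeq_pt_zero (h : IsCtilde N σ a b) (j : ℕ) :
    FreeGroup.lift (extSeq N σ a b) ((artinAut 0 * artinAut 0) (.of j)) =
      a * extSeq N σ a b j * a⁻¹ := by
  by_cases h0 : j = 0
  · subst h0
    rw [artinAut_zero_sq_of_zero]
    simp only [map_mul, map_inv, FreeGroup.lift_apply_of]
    exact h.left_conj_rightZero.symm
  by_cases h1 : j = 1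
  · subst h1
    rw [artinAut_zero_sq_of_one]
    simp only [map_mul, map_inv, FreeGroup.lift_apply_of]
    exact h.left_conj_right_zero.symm
  · obtain ⟨k, rfl⟩ := Nat.exists_eq_succ_of_ne_zero h0
    rw [artinAut_zero_sq_of_other h0 h1, FreeGroup.lift_apply_of]
    exact eq_mul_inv_of_mul_eq (h.commute_left_rightSeq (by omega)).eq.symm

/-- The universal property of `AffineModel (N + 1)`. -/
def retract (h : IsCtilde N σ a b) : AffineModel (N + 1) →* Γ :=
  SemidirectProduct.lift (FreeGroup.lift (extSeq N σ a b)) (FreeBraid.lift h.isBraidSystem_left)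
    fun g => MonoidHom.ext fun w => by
      simpa using equivariant_free_of_closure ((act (N + 1 + 1)).comp (incl (N + 1)))
        (FreeGroup.lift (extSeq N σ a b)) (FreeBraid.lift h.isBraidSystem_left)
        (FreeBraid.closure_gen_pt_zero (N + 1)) (by
          rintro _ (⟨i, hi, rfl⟩ | rfl | ⟨i, hi, rfl⟩) j
          · rw [MonoidHom.comp_apply, act_incl_br hi, FreeBraid.lift_br, extSeq_br h hi,
              FreeGroup.lift_apply_of]
          · rw [MonoidHom.comp_apply, act_incl_pt_zero (by omega), FreeBraid.lift_pt,
              extSeq_pt_zero h, FreeGroup.lift_apply_of, conjSeq]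
          · rw [MonoidHom.comp_apply, incl_pt_of_ge hi, FreeBraid.lift_pt,
              conjSeq_of_ge _ hi (by omega), map_one, MulAut.one_apply, one_mul, inv_one,
              mul_one]) g w

lemma retract_br (h : IsCtilde N σ a b) (i : ℕ) :
    retract h (SemidirectProduct.inr (FreeBraid.br (N + 1) i)) = σ i := by
  rw [retract, SemidirectProduct.lift_inr, FreeBraid.lift_br]

lemma retract_pt_zero (h : IsCtilde N σ a b) :
    retract h (SemidirectProduct.inr (FreeBraid.pt (N + 1) 0)) = a := by
  rw [retract, SemidirectProduct.lift_inr, FreeBraid.lift_pt, conjSeq]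

lemma retract_last (h : IsCtilde N σ a b) :
    retract h (SemidirectProduct.inl (.of (N + 1))) = b := by
  rw [retract, SemidirectProduct.lift_inl, FreeGroup.lift_apply_of, extSeq, rightSeq_self]

end Retract

section Center

variable {n : ℕ}

lemma expSum_zero_act (h : FreeBraid n) (w : FreeGroup ℕ) :
    expSum 0 (act (n + 1) (incl n h) w) = expSum 0 w := by
  have key := equivariant_free_of_closure ((act (n + 1)).comp (incl n)) (expSum 0)
    (1 : FreeBraid n →* Multiplicative ℤ) (FreeBraid.closure_gen_pt_zero n) (by
      rintro _ (⟨i, hi, rfl⟩ | rfl | ⟨i, hi, rfl⟩) j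
      · rw [MonoidHom.comp_apply, act_incl_br hi]
        by_cases h1 : j = i + 1
        · subst h1
          simp [artinAut_self, expSum_of]
        by_cases h2 : j = i + 1 + 1
        · subst h2
          simp [artinAut_succ, expSum_of]
        · simp [artinAut_other h1 h2]
      · rcases Nat.eq_zero_or_pos n with rfl | hn
        · simp [incl_pt_of_ge]
        rw [MonoidHom.comp_apply, act_incl_pt_zero hn]
        by_cases h0 : j = 0
        · subst h0
          rw [artinAut_zero_sq_of_zero]
          simp [expSum_of]
        by_cases h1 : j = 1
        · subst h1
          rw [artinAut_zero_sq_of_one]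
          simp [expSum_of]
        · rw [artinAut_zero_sq_of_other h0 h1]
          simp
      · simp [incl_pt_of_ge hi]) h w
  simpa using key

/-- The exponent sum of the first free generator. -/
def expSumZero (n : ℕ) : AffineModel n →* Multiplicative ℤ :=
  SemidirectProduct.lift (expSum 0) 1 fun h => MonoidHom.ext fun w => by
    simpa using expSum_zero_act h w

lemma freeBraid_eq_one (hn : 2 ≤ n) {h : FreeBraid n}
    (hbr : ∀ i, i + 1 < n → Commute h (FreeBraid.br n i)) (hpt : Commute h (FreeBraid.pt n 0))
    (hact : act (n + 1) (incl n h) = 1) : h = 1 := by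
  have hb : h.right = 1 := by
    refine eq_one_of_commute_of_act_eq_one (fun g => ?_) (MulEquiv.ext fun w => ?_)
    · induction g using gen_induction with
      | gen i hi => exact (hbr i hi).map SemidirectProduct.rightHom
      | one => exact Commute.one_right _
      | mul a b ha hb => exact ha.mul_right hb
      | inv a ha => exact ha.inv_right
    · obtain ⟨w, rfl⟩ := forget_surjective w
      rw [← forget_act_incl, hact, MulAut.one_apply, MulAut.one_apply]
  have hf : h = SemidirectProduct.inl h.left := by
    conv_lhs => rw [← SemidirectProduct.inl_left_mul_inr_right h, hb, map_one, mul_one]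
  have hpt1 : Commute h (FreeBraid.pt n 1) := by
    rw [← (FreeBraid.isBraidSystem n).conj_self 0 hn]
    exact ((hbr 0 hn).mul_right hpt).mul_right (hbr 0 hn).inv_right
  have hc : ∀ i, Commute h (FreeBraid.pt n i) → Commute h.left (.of i) := fun i hi => by
    rw [hf] at hi
    apply SemidirectProduct.inl_injective (φ := act n)
    rw [map_mul, map_mul]
    exact hi
  rw [hf, eq_one_of_commute_of_of zero_ne_one (hc 0 hpt) (hc 1 hpt1), map_one]

lemma exists_zpow_of_fixed {T : MulAut (FreeGroup ℕ)} (h1 : T (.of 1) = .of 1)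
    (h01 : T ((.of 0)⁻¹ * .of 1 * .of 0) = (.of 0)⁻¹ * .of 1 * .of 0) :
    ∃ a : ℤ, T (.of 0) = .of 1 ^ a * .of 0 := by
  rw [map_mul, map_mul, map_inv, h1] at h01
  have hc : Commute (T (.of 0) * (.of 0)⁻¹) (.of 1) := by
    rw [Commute, SemiconjBy]
    calc T (.of 0) * (.of 0)⁻¹ * .of 1 = T (.of 0) * ((.of 0)⁻¹ * .of 1 * .of 0) * (.of 0)⁻¹ := by
          group
      _ = _ := by rw [← h01]; group
  obtain ⟨a, ha⟩ := exists_eq_zpow_of_commute_of hc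
  exact ⟨a, by rw [← ha, inv_mul_cancel_right]⟩

lemma commute_inl_iff {z : AffineModel n} {w : FreeGroup ℕ} :
    Commute z (SemidirectProduct.inl w) ↔
      (MulAut.conj z.left * act (n + 1) (incl n z.right)) w = w := by
  rw [Commute, SemiconjBy, ← mul_inv_eq_iff_eq_mul,
    ← SemidirectProduct.inl_inj (φ := (act (n + 1)).comp (incl n))]
  conv_lhs => rw [← SemidirectProduct.inl_left_mul_inr_right z]
  rw [MulAut.mul_apply, MulAut.conj_apply, map_mul, map_mul, ← MonoidHom.comp_apply (act (n + 1)),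
    SemidirectProduct.inl_aut, mul_inv_rev]
  simp only [mul_assoc, map_inv]

lemma commute_inl_of {z : AffineModel n}
    (hbr : ∀ i, i + 1 < n → Commute z (SemidirectProduct.inr (FreeBraid.br n i)))
    (hlast : Commute z (SemidirectProduct.inl (.of n))) {k : ℕ} (h1 : 1 ≤ k) (hk : k ≤ n) :
    Commute z (SemidirectProduct.inl (.of k)) := by
  induction hk using Nat.decreasingInduction with
  | self => exact hlast
  | of_succ k hk ih =>
    have := ih (by omega)
    obtain ⟨i, rfl⟩ := Nat.exists_eq_succ_of_ne_zero (show k ≠ 0 by omega)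
    have hb := hbr i hk
    rw [Nat.succ_eq_add_one, ← artinAut_self (i + 1), ← act_incl_br hk,
      ← MonoidHom.comp_apply (act (n + 1)), SemidirectProduct.inl_aut] at this
    have h2 := (hb.inv_right.mul_right this).mul_right hb
    simpa [mul_assoc] using h2

theorem eq_one_of_commute (hn : 2 ≤ n) {z : AffineModel n}
    (hbr : ∀ i, i + 1 < n → Commute z (SemidirectProduct.inr (FreeBraid.br n i)))
    (hpt : Commute z (SemidirectProduct.inr (FreeBraid.pt n 0)))
    (hlast : Commute z (SemidirectProduct.inl (.of n))) (hχ : expSumZero n z = 1) : z = 1 := by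
  set T := MulAut.conj z.left * act (n + 1) (incl n z.right) with hT
  have hk : ∀ k, 1 ≤ k → k ≤ n → T (.of k) = .of k := fun k h1 h2 =>
    commute_inl_iff.1 (commute_inl_of hbr hlast h1 h2)
  have h01 : T ((.of 0)⁻¹ * .of 1 * .of 0) = (.of 0)⁻¹ * .of 1 * .of 0 := by
    have hc1 := commute_inl_of hbr hlast le_rfl (by omega)
    have hc2 := (hpt.mul_right hc1).mul_right hpt.inv_right
    rw [← map_inv, ← SemidirectProduct.inl_aut, MonoidHom.comp_apply, act_incl_pt_zero (by omega),
      artinAut_zero_sq_of_one] at hc2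
    have hc3 := (hc1.mul_right hc2).mul_right hc1.inv_right
    rw [← map_inv, ← map_mul, ← map_mul] at hc3
    rw [show (.of 0 : FreeGroup ℕ)⁻¹ * .of 1 * .of 0 =
      .of 1 * ((.of 0 * .of 1)⁻¹ * .of 1 * (.of 0 * .of 1)) * (.of 1)⁻¹ by group]
    exact commute_inl_iff.1 hc3
  obtain ⟨a, ha⟩ := exists_zpow_of_fixed (hk 1 le_rfl (by omega)) h01
  have htail : ∀ m ≤ n, T ((.of 0)⁻¹ * genProd (m + 1)) = (.of 0)⁻¹ * genProd (m + 1) :=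
    fun m hm => by
      induction m with
      | zero => simp [genProd]
      | succ m ih =>
        rw [genProd, ← mul_assoc, map_mul, ih (by omega), hk _ (by omega) hm]
  have hD1 : T (genProd (n + 1)) = .of 1 ^ a * genProd (n + 1) := by
    calc T (genProd (n + 1)) = T (.of 0 * ((.of 0)⁻¹ * genProd (n + 1))) := by group
      _ = _ := by rw [map_mul, htail n le_rfl, ha]; group
  have hD2 : T (genProd (n + 1)) = z.left * genProd (n + 1) * z.left⁻¹ := by
    rw [hT, MulAut.mul_apply, act_genProd, MulAut.conj_apply]
  have ha0 : a = 0 := by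
    have := congrArg (expSum 1) (hD1.symm.trans hD2)
    simpa [expSum_of] using this
  have hcD : Commute z.left (genProd (n + 1)) := by
    rw [ha0, zpow_zero, one_mul, hD2] at hD1
    exact mul_inv_eq_iff_eq_mul.1 hD1
  have hexp : ∀ m, expSum 0 (genProd (m + 1)) = Multiplicative.ofAdd 1 := fun m => by
    induction m with
    | zero => simp [genProd, expSum_of]
    | succ m ih => rw [genProd, map_mul, ih, expSum_of, if_neg (by omega), mul_one]
  obtain ⟨k, hf⟩ := exists_eq_zpow_of_commute hcD (hexp n)
  have hχ' : expSum 0 z.left = 1 := by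
    rw [← SemidirectProduct.inl_left_mul_inr_right z, expSumZero, map_mul,
      SemidirectProduct.lift_inl, SemidirectProduct.lift_inr] at hχ
    simpa using hχ
  have hf1 : z.left = 1 := by
    rw [hf, map_zpow, hexp, ← ofAdd_zsmul, ofAdd_eq_one, smul_eq_mul, mul_one] at hχ'
    rw [hf, hχ', zpow_zero]
  have hzr : z = SemidirectProduct.inr z.right := by
    conv_lhs => rw [← SemidirectProduct.inl_left_mul_inr_right z, hf1, map_one, one_mul]
  have hact : act (n + 1) (incl n z.right) = 1 := by
    rw [hf1, map_one, one_mul] at hT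
    rw [← hT]
    refine mulAut_freeGroup_ext fun j => ?_
    rw [MulAut.one_apply]
    obtain rfl | h1 := Nat.eq_zero_or_pos j
    · rw [ha, ha0, zpow_zero, one_mul]
    rcases Nat.lt_or_ge n j with h2 | h2
    · rw [hT, act_of_ge _ h2]
    · exact hk j h1 h2
  have hr : z.right = 1 := freeBraid_eq_one hn
    (fun i hi => (hbr i hi).map SemidirectProduct.rightHom)
    (hpt.map SemidirectProduct.rightHom) hact
  rw [hzr, hr, map_one]

end Center

end AffineModel

section Presentation

variable {n : ℕ}

/-- The generators of the presented group, extended trivially to all natural numbers. -/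
def artGen (n i : ℕ) : PresentedGroup (relsArtinCtilde n) :=
  if h : i < n + 1 then .of ⟨i, h⟩ else 1

lemma artGen_val (i : Fin (n + 1)) : artGen n i = .of i := dif_pos i.2

lemma four_first (hn : 1 ≤ n) : artGen n 0 * artGen n 1 * artGen n 0 * artGen n 1 =
    artGen n 1 * artGen n 0 * artGen n 1 * artGen n 0 := by
  simp only [artGen, show 0 < n + 1 by omega, show 1 < n + 1 by omega, dif_pos]
  exact mul_inv_eq_one.1 (PresentedGroup.one_of_mem (rels := relsArtinCtilde n)
    (Or.inl (Or.inl (Or.inl ⟨⟨0, by omega⟩, ⟨1, by omega⟩, rfl, rfl, rfl⟩))))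

lemma four_last {i : ℕ} (hi : i + 1 = n) :
    artGen n i * artGen n n * artGen n i * artGen n n =
      artGen n n * artGen n i * artGen n n * artGen n i := by
  simp only [artGen, show i < n + 1 by omega, show n < n + 1 by omega, dif_pos]
  exact mul_inv_eq_one.1 (PresentedGroup.one_of_mem (rels := relsArtinCtilde n)
    (Or.inl (Or.inl (Or.inr ⟨⟨i, by omega⟩, ⟨n, by omega⟩, hi, rfl, rfl⟩))))

lemma artGen_braid {i : ℕ} (h1 : 1 ≤ i) (hi : i + 2 ≤ n) :
    artGen n i * artGen n (i + 1) * artGen n i =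
      artGen n (i + 1) * artGen n i * artGen n (i + 1) := by
  simp only [artGen, show i < n + 1 by omega, show i + 1 < n + 1 by omega, dif_pos]
  exact mul_inv_eq_one.1 (PresentedGroup.one_of_mem (rels := relsArtinCtilde n)
    (Or.inl (Or.inr ⟨⟨i, by omega⟩, ⟨i + 1, by omega⟩, rfl, h1, hi, rfl⟩)))

lemma artGen_comm {i j : ℕ} (h : i + 2 ≤ j) : Commute (artGen n i) (artGen n j) := by
  by_cases hj : j < n + 1
  · rw [artGen, artGen, dif_pos hj, dif_pos (by omega)]
    exact mul_inv_eq_one.1 (PresentedGroup.one_of_mem (rels := relsArtinCtilde n)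
      (Or.inr ⟨⟨i, by omega⟩, ⟨j, by omega⟩, Or.inl h, rfl⟩))
  · rw [artGen, artGen, dif_neg hj]
    exact Commute.one_right _

lemma isCtilde_artGen {N : ℕ} (hN : 1 ≤ N) :
    IsCtilde N (fun i => if i + 1 < N + 1 then artGen (N + 1) (i + 1) else 1)
      (artGen (N + 1) 0) (artGen (N + 1) (N + 1)) where
  __ := IsBraid.truncate (fun _ _ h _ => artGen_comm (by omega))
    fun _ h => artGen_braid (by omega) (by omega)
  left_comm i h1 h2 := by
    rw [if_pos h2]
    exact (artGen_comm (by omega)).symm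
  left_four h := by
    rw [if_pos (by omega)]
    exact (four_first (by omega)).symm
  right_comm i h := by
    rw [if_pos (by omega)]
    exact artGen_comm (by omega)
  right_four := by
    rw [if_pos (by omega)]
    exact four_last (by omega)
  comm_ends := artGen_comm (by omega)

end Presentation

section Embedding

variable {n : ℕ}

lemma four_of_commute_conj {Γ : Type*} [Group Γ] {s y : Γ} (h : Commute s (y * (s * y * s⁻¹))) :
    s * y * s * y = y * s * y * s := by
  calc s * y * s * y = s * (y * (s * y * s⁻¹)) * s := by group
    _ = _ := by rw [h.eq]; group

namespace AffineModel

lemma inr_conj_inl (h : FreeBraid n) (w : FreeGroup ℕ) :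
    (SemidirectProduct.inr h : AffineModel n) * SemidirectProduct.inl w *
      (SemidirectProduct.inr h)⁻¹ = SemidirectProduct.inl (act (n + 1) (incl n h) w) := by
  rw [← map_inv, ← SemidirectProduct.inl_aut, MonoidHom.comp_apply]

lemma commute_inr_inl {h : FreeBraid n} {w : FreeGroup ℕ}
    (hw : act (n + 1) (incl n h) w = w) :
    Commute (SemidirectProduct.inr h : AffineModel n) (SemidirectProduct.inl w) := by
  rw [Commute, SemiconjBy, ← mul_inv_eq_iff_eq_mul, inr_conj_inl, hw]

/-- The images of the generators of the Artin group. -/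
def gen (n i : ℕ) : AffineModel n :=
  if i = 0 then SemidirectProduct.inr (FreeBraid.pt n 0)
  else if i < n then SemidirectProduct.inr (FreeBraid.br n (i - 1))
  else SemidirectProduct.inl (.of n)

lemma gen_zero (n : ℕ) : gen n 0 = SemidirectProduct.inr (FreeBraid.pt n 0) := if_pos rfl

lemma gen_succ {i : ℕ} (hi : i + 1 < n) :
    gen n (i + 1) = SemidirectProduct.inr (FreeBraid.br n i) := by
  rw [gen, if_neg (by omega), if_pos hi, Nat.add_sub_cancel]

lemma gen_self (hn : 0 < n) : gen n n = SemidirectProduct.inl (.of n) := by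
  rw [gen, if_neg (by omega), if_neg (by omega)]

lemma gen_four_first (hn : 2 ≤ n) :
    gen n 1 * gen n 0 * gen n 1 * gen n 0 = gen n 0 * gen n 1 * gen n 0 * gen n 1 := by
  rw [gen_zero, show gen n 1 = _ from gen_succ hn]
  refine four_of_commute_conj ?_
  simp only [← map_mul, ← map_inv]
  have hs := FreeBraid.isBraidSystem n
  rw [hs.conj_self 0 hn]
  exact (hs.conj_prod 0 hn).map _

lemma gen_four_last {i : ℕ} (hi : i + 2 = n) :
    gen n (i + 1) * gen n n * gen n (i + 1) * gen n n =
      gen n n * gen n (i + 1) * gen n n * gen n (i + 1) := by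
  rw [gen_self (by omega), gen_succ (by omega)]
  refine four_of_commute_conj ?_
  rw [inr_conj_inl, ← map_mul]
  refine commute_inr_inl ?_
  rw [act_incl_br (by omega)]
  subst hi
  simp only [map_mul, map_inv, artinAut_succ, artinAut_self]
  group

lemma gen_braid {i : ℕ} (h1 : 1 ≤ i) (hi : i + 2 ≤ n) :
    gen n i * gen n (i + 1) * gen n i = gen n (i + 1) * gen n i * gen n (i + 1) := by
  obtain ⟨i, rfl⟩ := Nat.exists_eq_succ_of_ne_zero (show i ≠ 0 by omega)
  rw [Nat.succ_eq_add_one, gen_succ (by omega), gen_succ (by omega)]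
  simp only [← map_mul]
  rw [(FreeBraid.isBraidSystem n).braid i (by omega)]

lemma gen_comm (hn : 2 ≤ n) {i j : ℕ} (hij : i + 2 ≤ j) (hj : j ≤ n) :
    Commute (gen n i) (gen n j) := by
  have hs := FreeBraid.isBraidSystem n
  obtain rfl | ⟨i, rfl⟩ : i = 0 ∨ ∃ k, i = k + 1 := by cases i <;> simp
  · rw [gen_zero]
    rcases hj.eq_or_lt with rfl | hj
    · rw [gen_self (by omega)]
      refine commute_inr_inl ?_
      rw [act_incl_pt_zero (by omega), artinAut_zero_sq_of_other (by omega) (by omega)]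
    · obtain ⟨j, rfl⟩ := Nat.exists_eq_succ_of_ne_zero (show j ≠ 0 by omega)
      rw [Nat.succ_eq_add_one, gen_succ hj]
      exact ((hs.conj_other j 0 hj (by omega) (by omega)).map _).symm
  · rw [gen_succ (by omega)]
    rcases hj.eq_or_lt with rfl | hj
    · rw [gen_self (by omega)]
      refine commute_inr_inl ?_
      rw [act_incl_br (by omega), artinAut_other (by omega) (by omega)]
    · obtain ⟨j, rfl⟩ := Nat.exists_eq_succ_of_ne_zero (show j ≠ 0 by omega)
      rw [Nat.succ_eq_add_one, gen_succ hj]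
      exact (hs.comm i j (by omega)).map _

lemma gen_rels (hn : 2 ≤ n) : ∀ r ∈ relsArtinCtilde n,
    FreeGroup.lift (fun i : Fin (n + 1) => gen n i) r = 1 := by
  rintro _ (((⟨i, j, hi, hj, rfl⟩ | ⟨i, j, hi, hj, rfl⟩) | ⟨i, j, hij, h1, h2, rfl⟩) |
    ⟨i, j, hij, rfl⟩)
  all_goals
    rw [map_mul, map_inv, mul_inv_eq_one]
    simp only [map_mul, FreeGroup.lift_apply_of]
  · rw [hi, hj, gen_four_first hn]
  · obtain ⟨k, hk⟩ : ∃ k, (i : ℕ) = k + 1 := ⟨i - 1, by omega⟩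
    rw [hj, hk, gen_four_last (by omega)]
  · rw [← hij, gen_braid h1 h2]
  · rcases hij with h | h
    · exact gen_comm hn h (by omega)
    · exact (gen_comm hn h (by omega)).symm

/-- The embedding of the Artin group. -/
def embed (hn : 2 ≤ n) : PresentedGroup (relsArtinCtilde n) →* AffineModel n :=
  PresentedGroup.toGroup (gen_rels hn)

lemma embed_artGen (hn : 2 ≤ n) {i : ℕ} (hi : i ≤ n) : embed hn (artGen n i) = gen n i := by
  rw [artGen, dif_pos (by omega), embed, PresentedGroup.toGroup.of]

lemma embed_injective (hn : 2 ≤ n) : Function.Injective (embed hn) := by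
  obtain ⟨N, rfl⟩ : ∃ N, n = N + 1 := ⟨n - 1, by omega⟩
  have h := isCtilde_artGen (N := N) (by omega)
  have key : (retract h).comp (embed hn) = MonoidHom.id _ := PresentedGroup.ext fun i => by
    rw [MonoidHom.comp_apply, MonoidHom.id_apply, ← artGen_val, embed_artGen hn (by omega)]
    rcases Nat.eq_zero_or_pos (i : ℕ) with h0 | h0
    · rw [h0, gen_zero, retract_pt_zero]
    obtain ⟨k, hk⟩ : ∃ k, (i : ℕ) = k + 1 := ⟨i - 1, by omega⟩
    rcases Nat.lt_or_ge (k + 1) (N + 1) with h1 | h1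
    · rw [hk, gen_succ h1, retract_br, if_pos h1]
    · rw [show (i : ℕ) = N + 1 by omega, gen_self (by omega), retract_last]
  exact Function.LeftInverse.injective (g := retract h) fun g => DFunLike.congr_fun key g

lemma expSumZero_embed (hn : 2 ≤ n) (g : PresentedGroup (relsArtinCtilde n)) :
    expSumZero n (embed hn g) = 1 := by
  have key : (expSumZero n).comp (embed hn) = 1 := PresentedGroup.ext fun i => by
    rw [MonoidHom.comp_apply, MonoidHom.one_apply, ← artGen_val, embed_artGen hn (by omega), gen]
    split_ifs
    · rw [expSumZero, SemidirectProduct.lift_inr, MonoidHom.one_apply]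
    · rw [expSumZero, SemidirectProduct.lift_inr, MonoidHom.one_apply]
    · rw [expSumZero, SemidirectProduct.lift_inl, expSum_of, if_neg (by omega)]
  exact DFunLike.congr_fun key g

lemma eq_one_of_mem_center (hn : 2 ≤ n) {z : PresentedGroup (relsArtinCtilde n)}
    (hz : z ∈ Subgroup.center (PresentedGroup (relsArtinCtilde n))) : z = 1 := by
  have hc : ∀ i ≤ n, Commute (embed hn z) (gen n i) := fun i hi => by
    rw [← embed_artGen hn hi]
    exact (show Commute z (artGen n i) from (Subgroup.mem_center_iff.1 hz _).symm).map _
  refine embed_injective hn ((eq_one_of_commute hn (fun i hi => ?_) ?_ ?_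
    (expSumZero_embed hn z)).trans (map_one _).symm)
  · rw [← gen_succ hi]
    exact hc _ (by omega)
  · rw [← gen_zero]
    exact hc _ (by omega)
  · rw [← gen_self (by omega)]
    exact hc _ le_rfl

end AffineModel

end Embedding

end ArtinCtilde

/-- the euclidean Artin group `Art(C̃_n)` (`n ≥ 2`) is torsion-free
and has trivial center. -/
theorem artinCtilde_torsionFree_and_centerless (n : ℕ) (hn : 2 ≤ n) :
    (∀ g : PresentedGroup (relsArtinCtilde n), IsOfFinOrder g → g = 1) ∧
    Subgroup.center (PresentedGroup (relsArtinCtilde n)) = ⊥ :=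
  ⟨fun _ hg => ArtinCtilde.AffineModel.embed_injective hn
    ((ArtinCtilde.AffineModel.torsionFree _ (MonoidHom.isOfFinOrder _ hg)).trans (map_one _).symm),
    (Subgroup.eq_bot_iff_forall _).2 fun _ => ArtinCtilde.AffineModel.eq_one_of_mem_center hn⟩
end

section
/- (Middle group) Fix n ≥ 1. Let M be the subgroup of the group of isometries of ℝⁿ generated by the reflections r_{ij} (1 ≤ i < j ≤ n) that interchange the i-th and j-th coordinates and the translations t_i by the standard basis vectors e_i. Then M consists exactly of the isometries of the form x ↦ v + σ·x with v ∈ ℤⁿ and σ a coordinate permutation, and M is isomorphic to the semidirect product ℤⁿ ⋊ Sym_n, where Sym_n acts on ℤⁿ by permuting coordinates and the translations t_i generate the normal free abelian subgroup ℤⁿ. -/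
noncomputable section

/-- `n`-dimensional euclidean space `ℝⁿ`. -/
abbrev Euc (n : ℕ) := EuclideanSpace ℝ (Fin n)

/-- An isometry of `ℝⁿ`: a surjective distance-preserving map. -/
abbrev Iso (n : ℕ) := Euc n ≃ᵢ Euc n

/-- The isometry `x ↦ v + σ·x` of `ℝⁿ`, for `v ∈ ℤⁿ` and `σ` a coordinate permutation. -/
def permTranslation {n : ℕ} (v : Fin n → ℤ) (σ : Equiv.Perm (Fin n)) : Iso n :=
  (LinearIsometryEquiv.piLpCongrLeft 2 ℝ ℝ σ).toIsometryEquiv.trans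
    (IsometryEquiv.addLeft (WithLp.toLp 2 fun k => (v k : ℝ)))

theorem permTranslation_apply {n : ℕ} (v : Fin n → ℤ) (σ : Equiv.Perm (Fin n))
    (x : Euc n) (k : Fin n) : permTranslation v σ x k = (v k : ℝ) + x (σ⁻¹ k) :=
  rfl

theorem eq_permTranslation_iff {n : ℕ} (g : Iso n) (v : Fin n → ℤ) (σ : Equiv.Perm (Fin n)) :
    g = permTranslation v σ ↔
      ∀ (x : Euc n) (k : Fin n), g x k = (v k : ℝ) + x (σ⁻¹ k) := by
  refine ⟨fun h x k => by rw [h, permTranslation_apply], fun h => ?_⟩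
  ext x k
  rw [h, permTranslation_apply]

theorem permTranslation_mul {n : ℕ} (v w : Fin n → ℤ) (σ τ : Equiv.Perm (Fin n)) :
    permTranslation v σ * permTranslation w τ =
      permTranslation (fun k => v k + w (σ⁻¹ k)) (σ * τ) := by
  rw [eq_permTranslation_iff]
  intro x k
  rw [IsometryEquiv.mul_apply, permTranslation_apply, permTranslation_apply, mul_inv_rev,
    Equiv.Perm.mul_apply]
  push_cast
  ring

theorem permTranslation_injective {n : ℕ} {v w : Fin n → ℤ} {σ τ : Equiv.Perm (Fin n)}
    (h : permTranslation v σ = permTranslation w τ) : v = w ∧ σ = τ := by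
  rw [eq_permTranslation_iff] at h
  have hv : v = w := by
    funext k
    simpa [permTranslation_apply] using h 0 k
  refine ⟨hv, inv_injective (Equiv.ext fun k => ?_)⟩
  subst hv
  have hk := h (EuclideanSpace.single (τ⁻¹ k) 1) k
  rw [permTranslation_apply, add_right_inj, PiLp.single_apply, PiLp.single_apply,
    if_pos rfl] at hk
  by_contra hne
  rw [if_neg hne] at hk
  exact zero_ne_one hk

/-- The action of `ℤⁿ ⋊ Sym_n` on `ℝⁿ` by isometries. -/
def semidirectToIso {n : ℕ} (φ : Equiv.Perm (Fin n) →* MulAut (Multiplicative (Fin n → ℤ)))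
    (hφ : ∀ (σ : Equiv.Perm (Fin n)) (v : Multiplicative (Fin n → ℤ)) (i : Fin n),
      Multiplicative.toAdd (φ σ v) i = Multiplicative.toAdd v (σ⁻¹ i)) :
    (Multiplicative (Fin n → ℤ) ⋊[φ] Equiv.Perm (Fin n)) →* Iso n :=
  MonoidHom.mk' (fun p => permTranslation (Multiplicative.toAdd p.left) p.right) fun p q => by
    rw [permTranslation_mul, SemidirectProduct.mul_left, SemidirectProduct.mul_right]
    congr 1
    funext k
    rw [toAdd_mul, Pi.add_apply, hφ]

theorem semidirectToIso_injective {n : ℕ}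
    (φ : Equiv.Perm (Fin n) →* MulAut (Multiplicative (Fin n → ℤ)))
    (hφ : ∀ (σ : Equiv.Perm (Fin n)) (v : Multiplicative (Fin n → ℤ)) (i : Fin n),
      Multiplicative.toAdd (φ σ v) i = Multiplicative.toAdd v (σ⁻¹ i)) :
    Function.Injective (semidirectToIso φ hφ) := fun _ _ h =>
  SemidirectProduct.ext (Multiplicative.toAdd.injective (permTranslation_injective h).1)
    (permTranslation_injective h).2

theorem ofAdd_eq_prod_single_zpow {n : ℕ} (v : Fin n → ℤ) :
    Multiplicative.ofAdd v =
      ∏ i, (Multiplicative.ofAdd (Pi.single i (1 : ℤ) : Fin n → ℤ)) ^ v i := by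
  apply Multiplicative.toAdd.injective
  rw [toAdd_prod]
  simp only [toAdd_zpow, toAdd_ofAdd]
  funext k
  simp [Finset.sum_apply, Pi.single_apply]

/-- A subgroup of `ℤⁿ ⋊ Sym_n` is everything once it contains the standard basis of `ℤⁿ` and
all transpositions. -/
theorem semidirect_subgroup_eq_top {n : ℕ}
    {φ : Equiv.Perm (Fin n) →* MulAut (Multiplicative (Fin n → ℤ))}
    (H : Subgroup (Multiplicative (Fin n → ℤ) ⋊[φ] Equiv.Perm (Fin n)))
    (hl : ∀ i, SemidirectProduct.inl (Multiplicative.ofAdd (Pi.single i 1)) ∈ H)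
    (hr : ∀ i j, i < j → SemidirectProduct.inr (Equiv.swap i j) ∈ H) : H = ⊤ := by
  have hperm : H.comap SemidirectProduct.inr = ⊤ := by
    rw [eq_top_iff, ← Equiv.Perm.closure_isSwap, Subgroup.closure_le]
    rintro _ ⟨i, j, hij, rfl⟩
    rcases lt_or_gt_of_ne hij with h | h
    · exact hr i j h
    · rw [Equiv.swap_comm]
      exact hr j i h
  have hvec : H.comap SemidirectProduct.inl = ⊤ := by
    rw [eq_top_iff]
    intro v _
    rw [← ofAdd_toAdd v, ofAdd_eq_prod_single_zpow]
    exact Subgroup.prod_mem _ fun i _ => Subgroup.zpow_mem (H.comap SemidirectProduct.inl) (hl i) _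
  rw [eq_top_iff]
  intro p _
  rw [← SemidirectProduct.inl_left_mul_inr_right p]
  exact H.mul_mem (Subgroup.mem_comap.1 (hvec ▸ Subgroup.mem_top p.left))
    (Subgroup.mem_comap.1 (hperm ▸ Subgroup.mem_top p.right))

/-- Middle group: the subgroup `M` of the isometry group of `ℝⁿ`
generated by the coordinate-interchanging reflections `r_{ij}` (`i < j`) and the
translations `t_i` by standard basis vectors consists exactly of the isometries
`x ↦ v + σ·x` with `v ∈ ℤⁿ` and `σ` a coordinate permutation, and `M` is isomorphic
to the semidirect product `ℤⁿ ⋊ Sym_n` (with `Sym_n` acting by permuting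
coordinates) in such a way that the translations `t_i` generate the normal free
abelian subgroup `ℤⁿ`. -/
theorem middle_group_structure (n : ℕ) (hn : 1 ≤ n)
    (r : Fin n → Fin n → Iso n)
    (hr : ∀ (i j : Fin n) (x : Euc n) (k : Fin n), r i j x k = x (Equiv.swap i j k))
    (t : Fin n → Iso n)
    (ht : ∀ (i : Fin n) (x : Euc n), t i x = x + EuclideanSpace.single i 1)
    (φ : Equiv.Perm (Fin n) →* MulAut (Multiplicative (Fin n → ℤ)))
    (hφ : ∀ (σ : Equiv.Perm (Fin n)) (v : Multiplicative (Fin n → ℤ)) (i : Fin n),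
      Multiplicative.toAdd (φ σ v) i = Multiplicative.toAdd v (σ⁻¹ i))
    (M : Subgroup (Iso n))
    (hM : M = Subgroup.closure
      ({g | ∃ i j : Fin n, i < j ∧ g = r i j} ∪ {g | ∃ i : Fin n, g = t i})) :
    (∀ g : Iso n, g ∈ M ↔ ∃ (v : Fin n → ℤ) (σ : Equiv.Perm (Fin n)),
        ∀ (x : Euc n) (k : Fin n), g x k = (v k : ℝ) + x (σ⁻¹ k)) ∧
    ∃ ψ : M ≃* (Multiplicative (Fin n → ℤ) ⋊[φ] Equiv.Perm (Fin n)),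
      ∀ (i : Fin n) (g : M), (g : Iso n) = t i →
        ψ g = SemidirectProduct.inl (Multiplicative.ofAdd (Pi.single i 1)) := by
  have hr' : ∀ i j, r i j = semidirectToIso φ hφ (SemidirectProduct.inr (Equiv.swap i j)) := by
    intro i j
    refine (eq_permTranslation_iff _ _ _).2 fun x k => ?_
    simp [hr]
  have ht' : ∀ i, t i =
      semidirectToIso φ hφ (SemidirectProduct.inl (Multiplicative.ofAdd (Pi.single i 1))) := by
    intro i
    refine (eq_permTranslation_iff _ _ _).2 fun x k => ?_
    simp [ht, Pi.single_apply, add_comm]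
    rfl
  have hrange : (semidirectToIso φ hφ).range = M := by
    apply le_antisymm
    · rw [MonoidHom.range_eq_map, Subgroup.map_le_iff_le_comap, top_le_iff, hM]
      refine semidirect_subgroup_eq_top _ (fun i => ?_) fun i j hij => ?_
      · exact Subgroup.subset_closure (Or.inr ⟨i, (ht' i).symm⟩)
      · exact Subgroup.subset_closure (Or.inl ⟨i, j, hij, (hr' i j).symm⟩)
    · rw [hM, Subgroup.closure_le]
      rintro _ (⟨i, j, -, rfl⟩ | ⟨i, rfl⟩)
      · exact ⟨_, (hr' i j).symm⟩
      · exact ⟨_, (ht' i).symm⟩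
  refine ⟨fun g => ?_, ?_⟩
  · rw [← hrange]
    simp only [← eq_permTranslation_iff]
    constructor
    · rintro ⟨p, rfl⟩
      exact ⟨Multiplicative.toAdd p.left, p.right, rfl⟩
    · rintro ⟨v, σ, rfl⟩
      exact ⟨⟨Multiplicative.ofAdd v, σ⟩, rfl⟩
  · refine ⟨((MonoidHom.ofInjective (semidirectToIso_injective φ hφ)).trans
      (MulEquiv.subgroupCongr hrange)).symm, fun i g hg => ?_⟩
    rw [MulEquiv.symm_apply_eq]
    exact Subtype.ext (hg.trans (ht' i))
end
end
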